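/- arXiv:1406.0349 — 2 statements merged into one kernel-verified Lean document; each statement's English description precedes it below -/
import Mathlib

section
/- There is no algorithm deciding finite satisfiability for DA expressions over a single relation name with difference degree at most two. Precisely: the set of DA expressions e over the one-element vocabulary {a} with deg e ≤ 2 such that e is finitely satisfiable is not a decidable (computable) set of expressions (under any standard effective encoding of expressions). -/
/-- Syntax of the Downward Algebra (DA): expressions built from relation names
in a vocabulary `Γ` using union, intersection, difference, and composition. -/
inductive DA (Γ : Type) : Type where
  | var : Γ → DA Γ
  | union : DA Γ → DA Γ → DA Γ
  | inter : DA Γ → DA Γ → DA Γ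
  | diff : DA Γ → DA Γ → DA Γ
  | comp : DA Γ → DA Γ → DA Γ

namespace DA

/-- Semantics: the binary relation `e(I)` defined by expression `e` in a structure `I`
(a structure over `Γ` with domain `D` assigns a binary relation on `D` to each name). -/
def eval {Γ D : Type} (I : Γ → D → D → Prop) : DA Γ → D → D → Prop
  | .var a => I a
  | .union e f => fun x y => eval I e x y ∨ eval I f x y
  | .inter e f => fun x y => eval I e x y ∧ eval I f x y
  | .diff e f => fun x y => eval I e x y ∧ ¬ eval I f x y
  | .comp e f => fun x y => ∃ z, eval I e x z ∧ eval I f z y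

/-- The difference degree of an expression. -/
def deg {Γ : Type} : DA Γ → ℕ
  | .var _ => 0
  | .union e f => max (deg e) (deg f)
  | .inter e f => max (deg e) (deg f)
  | .diff e f => max (deg e) (deg f) + 1
  | .comp e f => max (deg e) (deg f)

/-- A structure is finite when each relation is a finite binary relation. -/
def FiniteStruct {Γ D : Type} (I : Γ → D → D → Prop) : Prop :=
  ∀ a, {p : D × D | I a p.1 p.2}.Finite

/-- An expression is finitely satisfiable if some finite structure makes it
evaluate to a nonempty relation. -/
def FinSat {Γ : Type} (e : DA Γ) : Prop :=
  ∃ (D : Type) (I : Γ → D → D → Prop), FiniteStruct I ∧ ∃ x y, eval I e x y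

end DA

/-- A standard effective (injective) encoding of DA expressions over the single
relation name a (modelled by Unit) into the natural numbers. -/
def encodeDA : DA Unit → ℕ
  | .var _ => 0
  | .union e f => 5 * Nat.pair (encodeDA e) (encodeDA f) + 1
  | .inter e f => 5 * Nat.pair (encodeDA e) (encodeDA f) + 2
  | .diff e f => 5 * Nat.pair (encodeDA e) (encodeDA f) + 3
  | .comp e f => 5 * Nat.pair (encodeDA e) (encodeDA f) + 4

namespace DA

/-- Substitution of expressions for relation names. -/
def subst {Γ Δ : Type} (φ : Γ → DA Δ) : DA Γ → DA Δ
  | .var a => φ a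
  | .union e f => .union (subst φ e) (subst φ f)
  | .inter e f => .inter (subst φ e) (subst φ f)
  | .diff e f => .diff (subst φ e) (subst φ f)
  | .comp e f => .comp (subst φ e) (subst φ f)

theorem eval_subst {Γ Δ D : Type} (φ : Γ → DA Δ) (I : Δ → D → D → Prop) (e : DA Γ) :
    eval I (subst φ e) = eval (fun k => eval I (φ k)) e := by
  induction e <;> simp_all [subst, eval]

theorem deg_subst {Γ Δ : Type} (φ : Γ → DA Δ) (h : ∀ k, deg (φ k) = 0) (e : DA Γ) :
    deg (subst φ e) = deg e := by
  induction e <;> simp_all [subst, deg]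

theorem finite_eval {Γ D : Type} (I : Γ → D → D → Prop) (hI : FiniteStruct I) (e : DA Γ) :
    {p : D × D | eval I e p.1 p.2}.Finite := by
  induction e with
  | var a => exact hI a
  | union e f he hf => exact (he.union hf).subset (fun p hp => hp)
  | inter e f he hf => exact he.subset (fun p hp => hp.1)
  | diff e f he hf => exact he.subset (fun p hp => hp.1)
  | comp e f he hf =>
    refine ((he.prod hf).image (fun q => (q.1.1, q.2.2))).subset ?_
    rintro ⟨x, y⟩ ⟨z, h1, h2⟩
    exact ⟨((x, z), (z, y)), ⟨h1, h2⟩, rfl⟩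

/-- Evaluation commutes with pushing a structure forward along an injection. -/
theorem eval_image {Γ D D' : Type} (m : D → D') (hm : Function.Injective m)
    (J : Γ → D → D → Prop) (J' : Γ → D' → D' → Prop)
    (h : ∀ k u v, J' k u v ↔ ∃ x y, u = m x ∧ v = m y ∧ J k x y) (e : DA Γ) :
    ∀ u v, eval J' e u v ↔ ∃ x y, u = m x ∧ v = m y ∧ eval J e x y := by
  induction e with
  | var a => exact h a
  | union e f he hf => intro u v; simp only [eval, he, hf]; grind
  | inter e f he hf =>
    intro u v; simp only [eval, he, hf]
    constructor
    · rintro ⟨⟨x, y, rfl, rfl, h1⟩, x', y', h2, h3, h4⟩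
      cases hm h2; cases hm h3; exact ⟨_, _, rfl, rfl, h1, h4⟩
    · rintro ⟨x, y, rfl, rfl, h1, h2⟩; exact ⟨⟨_, _, rfl, rfl, h1⟩, _, _, rfl, rfl, h2⟩
  | diff e f he hf =>
    intro u v; simp only [eval, he, hf]
    constructor
    · rintro ⟨⟨x, y, rfl, rfl, h1⟩, h2⟩
      exact ⟨_, _, rfl, rfl, h1, fun h3 => h2 ⟨_, _, rfl, rfl, h3⟩⟩
    · rintro ⟨x, y, rfl, rfl, h1, h2⟩
      refine ⟨⟨_, _, rfl, rfl, h1⟩, ?_⟩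
      rintro ⟨x', y', h3, h4, h5⟩
      cases hm h3; cases hm h4; exact h2 h5
  | comp e f he hf =>
    intro u v; simp only [eval, he, hf]
    constructor
    · rintro ⟨z, ⟨x, y, rfl, rfl, h1⟩, x', y', h2, rfl, h4⟩
      cases hm h2; exact ⟨_, _, rfl, rfl, _, h1, h4⟩
    · rintro ⟨x, y, rfl, rfl, z, h1, h2⟩
      exact ⟨m z, ⟨_, _, rfl, rfl, h1⟩, _, _, rfl, rfl, h2⟩

/-- The `n+1`-fold composition of the single relation name. -/
def apow : ℕ → DA Unit
  | 0 => .var ()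
  | n + 1 => .comp (.var ()) (apow n)

/-- Opening mark of a gadget. -/
def markS : DA Unit := .inter (apow 0) (apow 1)
/-- Closing mark of a gadget. -/
def markT : DA Unit := .inter (apow 0) (apow 2)
/-- The expression for a gadget with inner path of length `n+1`. -/
def gad (n : ℕ) : DA Unit := .comp markS (.comp (apow n) markT)

theorem deg_apow (n : ℕ) : deg (apow n) = 0 := by
  induction n <;> simp_all [apow, deg]

theorem deg_gad (n : ℕ) : deg (gad n) = 0 := by
  simp [gad, markS, markT, deg, deg_apow]

/-- Vertices of the gadget graph; `G` is the type of gadgets. -/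
inductive GV (D G : Type) : Type
  | main : D → GV D G
  | s : G → GV D G
  | p : G → ℕ → GV D G
  | t1 : G → GV D G
  | t2 : G → GV D G

/-- Edges of the gadget graph: every gadget `g` in `P` is a marked path from `src g` to `tgt g`. -/
inductive GE {D G : Type} (P : G → Prop) (src tgt : G → D) (len : G → ℕ) :
    GV D G → GV D G → Prop
  | e1 (x g) : P g → x = src g → GE P src tgt len (.main x) (.s g)
  | e2 (x g i) : P g → x = src g → i = 0 → GE P src tgt len (.main x) (.p g i)
  | e3 (g i) : P g → i = 0 → GE P src tgt len (.s g) (.p g i)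
  | e4 (g i j) : P g → i < len g → j = i + 1 → GE P src tgt len (.p g i) (.p g j)
  | e5 (g i) : P g → i = len g → GE P src tgt len (.p g i) (.t1 g)
  | e6 (g) : P g → GE P src tgt len (.t1 g) (.t2 g)
  | e7 (g y) : P g → y = tgt g → GE P src tgt len (.t2 g) (.main y)
  | e8 (g i y) : P g → i = len g → y = tgt g → GE P src tgt len (.p g i) (.main y)

section
variable {D G : Type} {P : G → Prop} {src tgt : G → D} {len : G → ℕ}

theorem eval_markS (u v : GV D G) :
    eval (fun _ => GE P src tgt len) markS u v ↔
      ∃ g, P g ∧ u = .main (src g) ∧ v = .p g 0 := by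
  simp only [markS, eval, apow]
  constructor
  · rintro ⟨h1, z, h2, h3⟩
    cases h1 <;> cases h2 <;> cases h3 <;> grind
  · rintro ⟨g, hg, rfl, rfl⟩
    exact ⟨.e2 _ _ _ hg rfl rfl, .s g, .e1 _ _ hg rfl, .e3 _ _ hg rfl⟩

theorem eval_markT (hl : ∀ g, 2 ≤ len g) (u v : GV D G) :
    eval (fun _ => GE P src tgt len) markT u v ↔
      ∃ g, P g ∧ u = .p g (len g) ∧ v = .main (tgt g) := by
  simp only [markT, eval, apow]
  constructor
  · rintro ⟨h1, z, h2, z', h3, h4⟩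
    cases h1 <;> cases h4 <;> cases h2 <;> cases h3 <;> grind
  · rintro ⟨g, hg, rfl, rfl⟩
    exact ⟨.e8 _ _ _ hg rfl rfl, .t1 g, .e5 _ _ hg rfl, .t2 g, .e6 _ hg, .e7 _ _ hg rfl⟩

/-- Invariant of walks that start at the first inner vertex of `g`. -/
def GInv (len : G → ℕ) (g : G) (n : ℕ) : GV D G → Prop
  | .p g' i => (g' = g ∧ i = n ∧ n ≤ len g) ∨ i + len g < n
  | _ => len g < n

theorem GInv_step {g : G} {n : ℕ} {u v : GV D G} (h : GInv len g n u)
    (e : GE P src tgt len u v) : GInv len g (n + 1) v := by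
  cases e <;> simp only [GInv] at * <;> grind

theorem GInv_apow {g : G} (m : ℕ) : ∀ {n : ℕ} {u v : GV D G}, GInv len g n u →
    eval (fun _ => GE P src tgt len) (apow m) u v → GInv len g (n + (m + 1)) v := by
  induction m with
  | zero => intro n u v h e; exact GInv_step h e
  | succ m ih =>
    rintro n u v h ⟨z, h1, h2⟩
    have := ih (GInv_step h h1) h2
    rwa [show n + (m + 1 + 1) = n + 1 + (m + 1) by omega]

theorem apow_path {g : G} (hg : P g) (m : ℕ) : ∀ i, i + (m + 1) ≤ len g →
    eval (fun _ => GE P src tgt len) (apow m) (GV.p g i) (GV.p g (i + (m + 1))) := by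
  induction m with
  | zero => intro i hi; exact .e4 _ _ _ hg (by omega) rfl
  | succ m ih =>
    intro i hi
    refine ⟨.p g (i + 1), .e4 _ _ _ hg (by omega) rfl, ?_⟩
    have := ih (i + 1) (by omega)
    rwa [show i + (m + 1 + 1) = i + 1 + (m + 1) by omega]

theorem eval_gad (hl : ∀ g, 2 ≤ len g) (m : ℕ) (hm : ∀ g g', m + 1 < len g + len g')
    (u v : GV D G) :
    eval (fun _ => GE P src tgt len) (gad m) u v ↔
      ∃ g, P g ∧ len g = m + 1 ∧ u = .main (src g) ∧ v = .main (tgt g) := by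
  constructor
  · rintro ⟨z, h1, z', h2, h3⟩
    obtain ⟨g, hg, rfl, rfl⟩ := (eval_markS _ _).1 h1
    obtain ⟨g', hg', rfl, rfl⟩ := (eval_markT hl _ _).1 h3
    have := GInv_apow (g := g) (n := 0) m (by simp [GInv]) h2
    simp only [GInv] at this
    have := hm g' g
    grind
  · rintro ⟨g, hg, hlen, rfl, rfl⟩
    refine ⟨.p g 0, (eval_markS _ _).2 ⟨g, hg, rfl, rfl⟩, .p g (len g), ?_,
      (eval_markT hl _ _).2 ⟨g, hg, rfl, rfl⟩⟩
    have := apow_path (src := src) (tgt := tgt) (len := len) hg m 0 (by omega)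
    simpa [hlen] using this

theorem finite_GE (hP : {g | P g}.Finite) : {p : GV D G × GV D G | GE P src tgt len p.1 p.2}.Finite := by
  have : {v : GV D G | ∃ g, P g ∧ (v = .main (src g) ∨ v = .main (tgt g) ∨ v = .s g ∨ v = .t1 g ∨
      v = .t2 g ∨ ∃ i, i ≤ len g ∧ v = .p g i)}.Finite := by
    have h2 : (⋃ g ∈ {g | P g}, (({.main (src g), .main (tgt g), .s g, .t1 g, .t2 g} : Set (GV D G)) ∪
      (GV.p g) '' (Set.Iic (len g)))).Finite := by
      refine hP.biUnion (fun g _ => Set.Finite.union (Set.toFinite _) ((Set.finite_Iic _).image _))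
    refine h2.subset ?_
    rintro v ⟨g, hg, h⟩
    simp only [Set.mem_iUnion]
    refine ⟨g, hg, ?_⟩
    simp only [Set.mem_union, Set.mem_insert_iff, Set.mem_singleton_iff, Set.mem_image, Set.mem_Iic]
    grind
  refine (this.prod this).subset ?_
  rintro ⟨u, v⟩ h
  simp only [Set.mem_ofPred_eq] at h
  cases h <;> simp only [Set.mem_prod, Set.mem_ofPred_eq] <;> constructor <;> refine ⟨_, by assumption, ?_⟩ <;> grind

end

/-- Reduction of any finite vocabulary to a single relation name, keeping the degree. -/
theorem exists_single (Γ : Type) [Finite Γ] : ∃ φ : Γ → DA Unit, (∀ k, deg (φ k) = 0) ∧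
    ∀ e : DA Γ, FinSat (subst φ e) ↔ FinSat e := by
  obtain ⟨K, ⟨ι⟩⟩ := Finite.exists_equiv_fin Γ
  refine ⟨fun k => gad (K + ι k + 1), fun k => deg_gad _, fun e => ⟨?_, ?_⟩⟩
  · rintro ⟨D, I, hI, x, y, h⟩
    rw [eval_subst] at h
    exact ⟨D, _, fun k => finite_eval I hI _, x, y, h⟩
  · rintro ⟨D, J, hJ, x, y, h⟩
    let P : Γ × D × D → Prop := fun g => J g.1 g.2.1 g.2.2
    let len : Γ × D × D → ℕ := fun g => K + ι g.1 + 2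
    refine ⟨GV D (Γ × D × D), fun _ => GE P (fun g => g.2.1) (fun g => g.2.2) len, ?_,
      .main x, .main y, ?_⟩
    · intro _
      apply finite_GE
      have : (⋃ k : Γ, (fun p : D × D => (k, p)) '' {p | J k p.1 p.2}).Finite :=
        Set.finite_iUnion (fun k => (hJ k).image _)
      refine this.subset ?_
      rintro ⟨k, p⟩ hp
      simp only [Set.mem_iUnion]
      exact ⟨k, p, hp, rfl⟩
    · rw [eval_subst]
      refine (eval_image GV.main (fun a b h => by injection h) J _ ?_ e _ _).2 ⟨x, y, rfl, rfl, h⟩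
      intro k u v
      have hl : ∀ g, 2 ≤ len g := fun g => by simp only [len]; omega
      have hm : ∀ g g', K + ι k + 1 + 1 < len g + len g' := fun g g' => by
        simp only [len]; have := (ι k).2; omega
      refine (eval_gad hl _ hm u v).trans ?_
      constructor
      · rintro ⟨⟨k', x, y⟩, hg, hlen, rfl, rfl⟩
        have : k' = k := by
          apply ι.injective; apply Fin.ext; simp only [len] at hlen; omega
        subst this
        exact ⟨x, y, rfl, rfl, hg⟩
      · rintro ⟨x, y, rfl, rfl, hg⟩
        exact ⟨(k, x, y), hg, by simp only [len], rfl, rfl⟩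

end DA
namespace DA

/-- Relation names used in the multi-name expression. -/
inductive Nm (Λ X : Type) : Type
  | r : Nm Λ X
  | l : Λ → Nm Λ X
  | n : X → Nm Λ X

instance {Λ X : Type} [Finite Λ] [Finite X] : Finite (Nm Λ X) := by
  let f : Nm Λ X → Option (Λ ⊕ X) := fun a => match a with
    | .r => none
    | .l a => some (.inl a)
    | .n a => some (.inr a)
  apply Finite.of_injective f
  intro a b h
  cases a <;> cases b <;> simp_all [f]

section
variable {Λ X : Type}

/-- A letter, relativized to the order. -/
def lam (a : Λ) : DA (Nm Λ X) := .inter (.var (.l a)) (.var .r)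

/-- The expression of a grammar symbol. -/
def symE : Λ ⊕ X → DA (Nm Λ X)
  | .inl a => lam a
  | .inr A => .var (.n A)

/-- The expression of a sequence of grammar symbols. -/
def seqE : List (Λ ⊕ X) → DA (Nm Λ X)
  | [] => .var .r
  | [s] => symE s
  | s :: t => .comp (symE s) (seqE t)

/-- Union of a list of expressions. -/
def bigU (b : DA (Nm Λ X)) (es : List (DA (Nm Λ X))) : DA (Nm Λ X) := es.foldr .union b

/-- Sequences of symbols deriving words. -/
inductive DerSeq (R : List (X × List (Λ ⊕ X))) : List (Λ ⊕ X) → List Λ → Prop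
  | nil : DerSeq R [] []
  | letter (a s w) : DerSeq R s w → DerSeq R (.inl a :: s) (a :: w)
  | nt (A rhs s w₁ w₂) : (A, rhs) ∈ R → DerSeq R rhs w₁ → DerSeq R s w₂ →
      DerSeq R (.inr A :: s) (w₁ ++ w₂)

/-- The order relation name. -/
def rE : DA (Nm Λ X) := .var .r

/-- Any letter. -/
def anyE (h : Λ) (ls : List Λ) : DA (Nm Λ X) := bigU (lam h) (ls.map lam)

/-- Local violations. -/
def violE (h : Λ) (ls : List Λ) (R : List (X × List (Λ ⊕ X))) (F : List (List (Λ ⊕ X))) :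
    DA (Nm Λ X) :=
  bigU (.diff (.comp rE rE) rE)
    (.diff rE (.union (anyE h ls) (.comp (anyE h ls) rE)) ::
      (ls.map (fun a => .inter (lam a) (.comp rE rE)) ++
        (R.map (fun p => .diff (seqE p.2) (.var (.n p.1))) ++ F.map seqE)))

/-- Closure under left contexts. -/
def ctxL (V : DA (Nm Λ X)) : DA (Nm Λ X) :=
  .union V (.union (.comp rE V) (.comp rE (.comp rE V)))

/-- Closure under right contexts. -/
def ctxR (V : DA (Nm Λ X)) : DA (Nm Λ X) :=
  .union V (.union (.comp V rE) (.comp V (.comp rE rE)))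

/-- A fixed suffix of the word. -/
def sufE (pre : List Λ) (last : Λ) : DA (Nm Λ X) :=
  pre.foldr (fun a e => .comp (lam a) (.inter rE e)) (lam last)

/-- The positive part. -/
def posE (h : Λ) (pre : List Λ) (last : Λ) : DA (Nm Λ X) :=
  .comp (lam h) (.inter rE (.comp rE (.inter rE (sufE pre last))))

/-- The whole expression. -/
def mainE (h : Λ) (ls : List Λ) (R : List (X × List (Λ ⊕ X))) (F : List (List (Λ ⊕ X)))
    (pre : List Λ) (last : Λ) : DA (Nm Λ X) :=
  .diff (posE h pre last) (ctxR (ctxL (violE h ls R F)))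

theorem deg_lam (a : Λ) : deg (lam a : DA (Nm Λ X)) = 0 := by simp [lam, deg]

theorem deg_seqE (s : List (Λ ⊕ X)) : deg (seqE s) = 0 := by
  induction s with
  | nil => simp [seqE, deg]
  | cons a s ih =>
    have : deg (symE a) = 0 := by cases a <;> simp [symE, deg, deg_lam]
    cases s <;> simp_all [seqE, deg]

theorem deg_bigU (b : DA (Nm Λ X)) (es : List (DA (Nm Λ X))) (d : ℕ) (hb : deg b ≤ d)
    (h : ∀ e ∈ es, deg e ≤ d) : deg (bigU b es) ≤ d := by
  induction es with
  | nil => exact hb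
  | cons e es ih =>
    simp only [bigU, List.foldr_cons, deg, sup_le_iff] at *
    exact ⟨h e (by simp), ih (fun e he => h e (by simp [he]))⟩

theorem deg_anyE (h : Λ) (ls : List Λ) : deg (anyE h ls : DA (Nm Λ X)) = 0 := by
  apply Nat.le_zero.1
  apply deg_bigU
  · simp [deg_lam]
  · intro e he
    obtain ⟨a, _, rfl⟩ := List.mem_map.1 he
    simp [deg_lam]

theorem deg_violE (h : Λ) (ls : List Λ) (R : List (X × List (Λ ⊕ X))) (F : List (List (Λ ⊕ X))) :
    deg (violE h ls R F) ≤ 1 := by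
  apply deg_bigU
  · simp [deg, rE]
  · intro e he
    simp only [List.mem_cons, List.mem_append, List.mem_map] at he
    rcases he with rfl | ⟨a, _, rfl⟩ | ⟨a, _, rfl⟩ | ⟨a, _, rfl⟩ <;>
      simp [deg, rE, deg_lam, deg_seqE, deg_anyE]

theorem deg_sufE (pre : List Λ) (last : Λ) : deg (sufE pre last : DA (Nm Λ X)) = 0 := by
  induction pre with
  | nil => simp [sufE, deg_lam]
  | cons a s ih =>
    simp only [sufE, List.foldr_cons, deg] at *
    rw [ih]; simp [deg_lam, rE, deg]

theorem deg_mainE (h : Λ) (ls : List Λ) (R : List (X × List (Λ ⊕ X))) (F : List (List (Λ ⊕ X)))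
    (pre : List Λ) (last : Λ) : deg (mainE h ls R F pre last) ≤ 2 := by
  have := deg_violE h ls R F
  simp only [mainE, posE, ctxR, ctxL, deg, deg_lam, deg_sufE, rE]
  omega

variable {D : Type} (I : Nm Λ X → D → D → Prop)

theorem eval_bigU (b : DA (Nm Λ X)) (es : List (DA (Nm Λ X))) (x y : D) :
    eval I (bigU b es) x y ↔ eval I b x y ∨ ∃ e ∈ es, eval I e x y := by
  induction es with
  | nil => simp [bigU]
  | cons e es ih =>
    simp only [bigU, List.foldr_cons, eval, List.mem_cons, exists_eq_or_imp] at *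
    rw [ih]; tauto

theorem eval_anyE {h : Λ} {ls : List Λ} (hls : ∀ a, a ∈ ls) (x y : D) :
    eval I (anyE h ls) x y ↔ ∃ a, eval I (lam a) x y := by
  rw [anyE, eval_bigU]
  simp only [List.mem_map, exists_exists_and_eq_and]
  constructor
  · rintro (h1 | ⟨a, _, h1⟩) <;> exact ⟨_, h1⟩
  · rintro ⟨a, h1⟩; exact Or.inr ⟨a, hls a, h1⟩

/-- Semantics of symbol sequences, with the empty sequence denoting identity. -/
def seqR : List (Λ ⊕ X) → D → D → Prop
  | [] => fun x y => x = y
  | s :: t => fun x y => ∃ z, eval I (symE s) x z ∧ seqR t z y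

theorem eval_seqE {s : List (Λ ⊕ X)} (hs : s ≠ []) (x y : D) :
    eval I (seqE s) x y ↔ seqR I s x y := by
  induction s generalizing x with
  | nil => simp at hs
  | cons a s ih =>
    cases s with
    | nil => simp [seqE, seqR]
    | cons b s => simp only [seqE, eval, seqR] at *; simp [ih]

theorem eval_violE {h : Λ} {ls : List Λ} (hls : ∀ a, a ∈ ls) {R : List (X × List (Λ ⊕ X))}
    {F : List (List (Λ ⊕ X))} (hR : ∀ p ∈ R, p.2 ≠ []) (hF : ∀ s ∈ F, s ≠ []) (x y : D) :
    eval I (violE h ls R F) x y ↔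
      ((∃ z, I .r x z ∧ I .r z y) ∧ ¬ I .r x y) ∨
      (I .r x y ∧ ¬ ((∃ a, eval I (lam a) x y) ∨ ∃ z a, eval I (lam a) x z ∧ I .r z y)) ∨
      (∃ a, eval I (lam a) x y ∧ ∃ z, I .r x z ∧ I .r z y) ∨
      (∃ A rhs, (A, rhs) ∈ R ∧ seqR I rhs x y ∧ ¬ I (.n A) x y) ∨
      (∃ s ∈ F, seqR I s x y) := by
  rw [violE, eval_bigU]
  refine or_congr (by simp [eval, rE]) ?_
  simp only [List.mem_cons, List.mem_append, List.mem_map, or_and_right, exists_or, exists_eq_left]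
  refine or_congr ?_ (or_congr ?_ (or_congr ?_ ?_))
  · simp [eval, rE, eval_anyE I hls]
  · constructor
    · rintro ⟨_, ⟨a, _, rfl⟩, h1⟩; exact ⟨a, h1⟩
    · rintro ⟨a, h1⟩; exact ⟨_, ⟨a, hls a, rfl⟩, h1⟩
  · constructor
    · rintro ⟨_, ⟨⟨A, rhs⟩, hp, rfl⟩, h1, h2⟩
      exact ⟨A, rhs, hp, (eval_seqE I (hR _ hp) _ _).1 h1, h2⟩
    · rintro ⟨A, rhs, hp, h1, h2⟩
      exact ⟨_, ⟨⟨A, rhs⟩, hp, rfl⟩, (eval_seqE I (hR _ hp) _ _).2 h1, h2⟩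
  · constructor
    · rintro ⟨_, ⟨s, hp, rfl⟩, h1⟩
      exact ⟨s, hp, (eval_seqE I (hF _ hp) _ _).1 h1⟩
    · rintro ⟨s, hp, h1⟩
      exact ⟨_, ⟨s, hp, rfl⟩, (eval_seqE I (hF _ hp) _ _).2 h1⟩

/-- The word avoids all forbidden patterns. -/
def Avoids (R : List (X × List (Λ ⊕ X))) (F : List (List (Λ ⊕ X))) (w : List Λ) : Prop :=
  ∀ s ∈ F, ∀ a l b, w = a ++ (l ++ b) → ¬ DerSeq R s l

/-! ### From words to structures -/

/-- The canonical structure of a word; elements are suffixes of the word. -/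
def canon (R : List (X × List (Λ ⊕ X))) (w : List Λ) : Nm Λ X → List Λ → List Λ → Prop
  | .r => fun u v => u <:+ w ∧ ∃ t, t ≠ [] ∧ u = t ++ v
  | .l a => fun u v => u <:+ w ∧ u = a :: v
  | .n A => fun u v => u <:+ w ∧ ∃ t, DerSeq R [.inr A] t ∧ u = t ++ v

theorem finite_canon (R : List (X × List (Λ ⊕ X))) (w : List Λ) : FiniteStruct (canon R w) := by
  intro k
  have h : {u | u <:+ w}.Finite := by
    refine (List.finite_toSet w.tails).subset ?_
    intro u hu
    simpa using hu
  refine (h.prod h).subset ?_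
  rintro ⟨u, v⟩ hk
  have key : ∀ t : List Λ, u <:+ w → u = t ++ v → u <:+ w ∧ v <:+ w := fun t h1 h2 =>
    ⟨h1, (show v <:+ u from ⟨t, h2.symm⟩).trans h1⟩
  cases k with
  | r => obtain ⟨h1, t, _, h2⟩ := hk; exact key t h1 h2
  | l a => obtain ⟨h1, h2⟩ := hk; exact key [a] h1 h2
  | n A => obtain ⟨h1, t, _, h2⟩ := hk; exact key t h1 h2

theorem eval_lam_canon (R : List (X × List (Λ ⊕ X))) (w : List Λ) (a : Λ) (u v : List Λ) :
    eval (canon R w) (lam a) u v ↔ u <:+ w ∧ u = a :: v := by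
  simp only [lam, eval, canon]
  constructor
  · rintro ⟨h, _⟩; exact h
  · rintro h; exact ⟨h, h.1, [a], by simp, h.2⟩

theorem seqR_canon {R : List (X × List (Λ ⊕ X))} {w : List Λ} (s : List (Λ ⊕ X)) :
    ∀ u v, seqR (canon R w) s u v → ∃ t, DerSeq R s t ∧ u = t ++ v := by
  induction s with
  | nil => intro u v h; exact ⟨[], .nil, h⟩
  | cons a s ih =>
    rintro u v ⟨z, h1, h2⟩
    obtain ⟨t, ht, rfl⟩ := ih _ _ h2
    cases a with
    | inl a =>
      obtain ⟨_, rfl⟩ := (eval_lam_canon _ _ _ _ _).1 h1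
      exact ⟨a :: t, .letter _ _ _ ht, rfl⟩
    | inr A =>
      obtain ⟨_, t', ht', rfl⟩ := h1
      refine ⟨t' ++ t, ?_, by simp⟩
      cases ht' with
      | nt _ rhs _ w1 w2 hm h3 h4 =>
        cases h4
        simpa using DerSeq.nt A rhs s w1 t hm h3 ht

theorem seqR_suffix {R : List (X × List (Λ ⊕ X))} {w : List Λ} {s : List (Λ ⊕ X)} (hs : s ≠ [])
    {u v} (h : seqR (canon R w) s u v) : u <:+ w := by
  cases s with
  | nil => simp at hs
  | cons a s =>
    obtain ⟨z, h1, h2⟩ := h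
    cases a with
    | inl a => exact ((eval_lam_canon _ _ _ _ _).1 h1).1
    | inr A => exact h1.1

theorem not_viol_canon {h : Λ} {ls : List Λ} (hls : ∀ a, a ∈ ls) {R : List (X × List (Λ ⊕ X))}
    {F : List (List (Λ ⊕ X))} (hR : ∀ p ∈ R, p.2 ≠ []) (hF : ∀ s ∈ F, s ≠ []) {w : List Λ}
    (hw : Avoids R F w) (u v : List Λ) : ¬ eval (canon R w) (violE h ls R F) u v := by
  rw [eval_violE _ hls hR hF]
  rintro (⟨⟨z, h1, h2⟩, h3⟩ | ⟨h1, h2⟩ | ⟨a, h1, z, h2, h3⟩ | ⟨A, rhs, hm, h1, h2⟩ | ⟨s, hs, h1⟩)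
  · obtain ⟨h0, t, ht, rfl⟩ := h1
    obtain ⟨_, t', ht', rfl⟩ := h2
    exact h3 ⟨h0, t ++ t', by simp [ht], by simp⟩
  · obtain ⟨h0, t, ht, rfl⟩ := h1
    apply h2
    simp only [eval_lam_canon]
    cases t with
    | nil => simp at ht
    | cons a t =>
      by_cases h' : t = []
      · subst h'; exact Or.inl ⟨a, h0, rfl⟩
      · refine Or.inr ⟨t ++ v, a, ⟨h0, rfl⟩, ?_, t, h', rfl⟩
        exact (List.suffix_cons a _).trans h0
  · obtain ⟨_, rfl⟩ := (eval_lam_canon _ _ _ _ _).1 h1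
    obtain ⟨_, t, ht, h4⟩ := h2
    obtain ⟨_, t', ht', rfl⟩ := h3
    have := congrArg List.length h4
    have := List.length_pos_iff.2 ht
    have := List.length_pos_iff.2 ht'
    simp at *
    omega
  · apply h2
    have h3 := seqR_suffix (hR _ hm) h1
    obtain ⟨t, ht, rfl⟩ := seqR_canon _ _ _ h1
    exact ⟨h3, t, by simpa using DerSeq.nt A rhs [] t [] hm ht .nil, rfl⟩
  · obtain ⟨a, ha⟩ := seqR_suffix (hF _ hs) h1
    obtain ⟨t, ht, rfl⟩ := seqR_canon _ _ _ h1
    exact hw s hs a t v ha.symm ht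

theorem eval_sufE_canon (R : List (X × List (Λ ⊕ X))) (w : List Λ) (pre : List Λ) (last : Λ) :
    (pre ++ [last]) <:+ w → eval (canon R w) (sufE pre last) (pre ++ [last]) [] := by
  induction pre with
  | nil => intro h; exact (eval_lam_canon _ _ _ _ _).2 ⟨h, rfl⟩
  | cons a pre ih =>
    intro h
    have h' : (pre ++ [last]) <:+ w := (List.suffix_cons a _).trans h
    exact ⟨pre ++ [last], (eval_lam_canon _ _ _ _ _).2 ⟨h, rfl⟩, ⟨h', pre ++ [last], by simp, by simp⟩, ih h'⟩

theorem finSat_of_word {h : Λ} {ls : List Λ} (hls : ∀ a, a ∈ ls) {R : List (X × List (Λ ⊕ X))}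
    {F : List (List (Λ ⊕ X))} (hR : ∀ p ∈ R, p.2 ≠ []) (hF : ∀ s ∈ F, s ≠ []) {pre : List Λ}
    {last : Λ} {t : List Λ} (ht : t ≠ []) (hw : Avoids R F (h :: (t ++ (pre ++ [last])))) :
    FinSat (mainE h ls R F pre last) := by
  refine ⟨List Λ, canon R _, finite_canon R (h :: (t ++ (pre ++ [last]))),
    h :: (t ++ (pre ++ [last])), [], ?_, ?_⟩
  · have h1 : (t ++ (pre ++ [last])) <:+ (h :: (t ++ (pre ++ [last]))) := List.suffix_cons _ _
    have h2 : (pre ++ [last]) <:+ (h :: (t ++ (pre ++ [last]))) :=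
      (List.suffix_append _ _).trans h1
    refine ⟨_, (eval_lam_canon _ _ _ _ _).2 ⟨List.suffix_rfl, rfl⟩, ⟨h1, t ++ (pre ++ [last]), by simp, by simp⟩,
      pre ++ [last], ⟨h1, t, ht, rfl⟩, ⟨h2, pre ++ [last], by simp, by simp⟩, eval_sufE_canon _ _ _ _ h2⟩
  · simp [ctxL, ctxR, eval, not_viol_canon hls hR hF hw]

/-! ### From structures to words -/

/-- `z` lies between `x` and `y`. -/
def Good (x y z : D) : Prop := (x = z ∨ I .r x z) ∧ (z = y ∨ I .r z y)

/-- Labelled paths through good points. -/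
inductive Path (x y : D) : D → List Λ → D → Prop
  | nil (z) : Good I x y z → Path x y z [] z
  | cons (z v w a l) : Good I x y z → eval I (lam a) z v → Path x y v l w → Path x y z (a :: l) w

variable {I}
theorem Path.left {x y z w : D} {l : List Λ} (h : Path I x y z l w) : Good I x y z := by
  cases h <;> assumption

theorem Path.right {x y z w : D} {l : List Λ} (h : Path I x y z l w) : Good I x y w := by
  induction h <;> assumption

theorem Path.append {x y z v w : D} {l m : List Λ} (h : Path I x y z l v) (h' : Path I x y v m w) :
    Path I x y z (l ++ m) w := by
  induction h with
  | nil => exact h'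
  | cons z v w a l hg he _ ih => exact .cons _ _ _ _ _ hg he (ih h')

theorem Path.split {x y w : D} {l m : List Λ} : ∀ {z}, Path I x y z (l ++ m) w →
    ∃ v, Path I x y z l v ∧ Path I x y v m w := by
  induction l with
  | nil => intro z h; exact ⟨z, .nil _ h.left, h⟩
  | cons a l ih =>
    intro z h
    cases h with
    | cons _ v _ _ _ hg he hp =>
      obtain ⟨u, h1, h2⟩ := ih hp
      exact ⟨u, .cons _ _ _ _ _ hg he h1, h2⟩

theorem word_of_finSat {h : Λ} {ls : List Λ} (hls : ∀ a, a ∈ ls) {R : List (X × List (Λ ⊕ X))}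
    {F : List (List (Λ ⊕ X))} (hR : ∀ p ∈ R, p.2 ≠ []) (hF : ∀ s ∈ F, s ≠ []) {pre : List Λ}
    {last : Λ} (hsat : FinSat (mainE h ls R F pre last)) :
    ∃ t, t ≠ [] ∧ Avoids R F (h :: (t ++ (pre ++ [last]))) := by
  obtain ⟨D, I, hfin, x, y, ⟨z0, hz0, hz0y, z1, hz01, hz1y, hsuf⟩, hbad⟩ := hsat
  simp only [rE, eval] at hz0y hz01 hz1y
  -- no violation in context
  have hV : ∀ z w, (x = z ∨ I .r x z ∨ ∃ v, I .r x v ∧ I .r v z) →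
      (w = y ∨ I .r w y ∨ ∃ v, I .r w v ∧ I .r v y) → ¬ eval I (violE h ls R F) z w := by
    intro z w h1 h2 h3
    apply hbad
    have h4 : eval I (ctxL (violE h ls R F)) x w := by
      rcases h1 with rfl | h1 | ⟨v, h1, h1'⟩
      · exact Or.inl h3
      · exact Or.inr (Or.inl ⟨z, h1, h3⟩)
      · exact Or.inr (Or.inr ⟨v, h1, z, h1', h3⟩)
    rcases h2 with rfl | h2 | ⟨v, h2, h2'⟩
    · exact Or.inl h4
    · exact Or.inr (Or.inl ⟨w, h4, h2⟩)
    · exact Or.inr (Or.inr ⟨w, h4, v, h2, h2'⟩)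
  simp only [eval_violE I hls hR hF, not_or] at hV
  have htr : ∀ z w v, (x = z ∨ I .r x z ∨ ∃ v, I .r x v ∧ I .r v z) →
      (w = y ∨ I .r w y ∨ ∃ v, I .r w v ∧ I .r v y) → I .r z v → I .r v w → I .r z w := by
    intro z w v h1 h2 h3 h4
    by_contra h5
    exact (hV z w h1 h2).1 ⟨⟨v, h3, h4⟩, h5⟩
  have hlr : ∀ a z v, eval I (lam a) z v → I .r z v := fun a z v hh => hh.2
  have hxz0 := hlr _ _ _ hz0
  have hxy : I .r x y := htr x y z0 (.inl rfl) (.inl rfl) hxz0 hz0y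
  have gx : Good I x y x := ⟨.inl rfl, .inr hxy⟩
  have gy : Good I x y y := ⟨.inr hxy, .inl rfl⟩
  have gz0 : Good I x y z0 := ⟨.inr hxz0, .inr hz0y⟩
  have gz1 : Good I x y z1 := ⟨.inr (htr x z1 z0 (.inl rfl) (.inr (.inl hz1y)) hxz0 hz01), .inr hz1y⟩
  have gtr : ∀ z w v, Good I x y z → Good I x y w → I .r z v → I .r v w → I .r z w := by
    intro z w v hz hw
    refine htr z w v ?_ ?_
    · rcases hz.1 with h | h <;> simp [h]
    · rcases hw.2 with h | h <;> simp [h]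
  have gbt : ∀ z w v, Good I x y z → Good I x y w → I .r z v → I .r v w → Good I x y v := by
    intro z w v hz hw h1 h2
    constructor
    · right
      rcases hz.1 with rfl | h
      · exact h1
      · refine htr x v z (.inl rfl) ?_ h h1
        rcases hw.2 with rfl | h'
        · exact .inr (.inl h2)
        · exact .inr (.inr ⟨w, h2, h'⟩)
    · right
      rcases hw.2 with rfl | h
      · exact h2
      · refine htr v y w ?_ (.inl rfl) h2 h
        rcases hz.1 with rfl | h'
        · exact .inr (.inl h1)
        · exact .inr (.inr ⟨z, h', h1⟩)
  have hG : ∀ z w, Good I x y z → Good I x y w → _ := fun z w hz hw => hV z w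
    (by rcases hz.1 with h | h <;> simp [h]) (by rcases hw.2 with h | h <;> simp [h])
  -- the fixed suffix
  have hsufP : ∀ (pre : List Λ) z, Good I x y z → eval I (sufE pre last) z y →
      Path I x y z (pre ++ [last]) y := by
    intro pre
    induction pre with
    | nil => intro z hz he; exact .cons _ _ _ _ _ hz he (.nil _ gy)
    | cons a pre ih =>
      rintro z hz ⟨v, h1, h2, h3⟩
      have gv : Good I x y v := gbt z y v hz gy (hlr _ _ _ h1) h2
      exact .cons _ _ _ _ _ hz h1 (ih v gv h3)
  -- unwinding the order
  have hfinv : ∀ z w, {v | I .r z v ∧ I .r v w}.Finite := by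
    intro z w
    refine ((hfin .r).image Prod.snd).subset ?_
    rintro v ⟨h1, _⟩
    exact ⟨(z, v), h1, rfl⟩
  have hunw : ∀ (n : ℕ) z w, {v | I .r z v ∧ I .r v w}.ncard = n → Good I x y z → Good I x y w →
      I .r z w → ∃ l, l ≠ [] ∧ Path I x y z l w := by
    intro n
    induction n using Nat.strong_induction_on with
    | _ n ih =>
      intro z w hn hz hw hzw
      have h1 := (hG z w hz hw).2.1
      have h2 : (∃ a, eval I (lam a) z w) ∨ ∃ v a, eval I (lam a) z v ∧ I .r v w := by
        by_contra h2; exact h1 ⟨hzw, not_or.1 h2⟩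
      rcases h2 with ⟨a, ha⟩ | ⟨v, a, ha, hv⟩
      · exact ⟨[a], by simp, .cons _ _ _ _ _ hz ha (.nil _ hw)⟩
      · have hzv := hlr _ _ _ ha
        have gv := gbt z w v hz hw hzv hv
        have hlt : {u | I .r v u ∧ I .r u w}.ncard < n := by
          rw [← hn]
          apply Set.ncard_lt_ncard _ (hfinv z w)
          refine ⟨?_, ?_⟩
          · rintro u ⟨h3, h4⟩
            exact ⟨gtr z u v hz (gbt v w u gv hw h3 h4) hzv h3, h4⟩
          · intro hsub
            have h3 : I .r v v := (hsub (show v ∈ _ from ⟨hzv, hv⟩)).1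
            exact (hG z v hz gv).2.2.1 ⟨a, ha, v, hzv, h3⟩
        obtain ⟨l, _, hl⟩ := ih _ hlt v w rfl gv hw hv
        exact ⟨a :: l, by simp, .cons _ _ _ _ _ hz ha hl⟩
  obtain ⟨t, ht, hpt⟩ := hunw _ z0 z1 rfl gz0 gz1 hz01
  have hpath : Path I x y x (h :: (t ++ (pre ++ [last]))) y :=
    .cons _ _ _ _ _ gx hz0 (hpt.append (hsufP pre z1 gz1 hsuf))
  -- derivations
  have hder : ∀ s l, DerSeq R s l → ∀ z w, Path I x y z l w → seqR I s z w := by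
    intro s l hd
    induction hd with
    | nil => intro z w hp; cases hp; rfl
    | letter a s l _ ih =>
      intro z w hp
      cases hp with
      | cons _ v _ _ _ hg he hp => exact ⟨v, he, ih _ _ hp⟩
    | nt A rhs s w1 w2 hm _ _ ih1 ih2 =>
      intro z w hp
      obtain ⟨v, hp1, hp2⟩ := hp.split
      refine ⟨v, ?_, ih2 _ _ hp2⟩
      by_contra hA
      exact (hG z v hp1.left hp1.right).2.2.2.1 ⟨A, rhs, hm, ih1 _ _ hp1, hA⟩
  refine ⟨t, ht, ?_⟩
  intro s hs a l b hw hd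
  rw [hw] at hpath
  obtain ⟨z, _, h2⟩ := hpath.split
  obtain ⟨w, h3, _⟩ := h2.split
  exact (hG z w h3.left h3.right).2.2.2.2 ⟨s, hs, hder s l hd z w h3⟩

end
end DA

namespace DA
namespace MW

/-- Actions on a family of stacks. -/
inductive Act (K G : Type) : Type
  | nop : Act K G
  | push : K → G → Act K G
  | pop : K → Option G → Act K G
  | peek : K → Option G → Act K G

/-- A multi-stack machine with transitions as letters. -/
structure Mach (Λ Q K G : Type) where
  start : Λ
  src : Λ → Q
  tgt : Λ → Q
  act : Λ → Act K G

section
set_option linter.unusedSectionVars false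
variable {Λ Q K G : Type} [DecidableEq K]

/-- Effect of an action. -/
def Apply : Act K G → (K → List G) → (K → List G) → Prop
  | .nop, S, S' => S' = S
  | .push k g, S, S' => S' = Function.update S k (g :: S k)
  | .pop k c, S, S' => (S k).head? = c ∧ S' = Function.update S k (S k).tail
  | .peek k c, S, S' => (S k).head? = c ∧ S' = S

/-- The action reads `c` on top of stack `k`. -/
def Reads (α : Act K G) (k : K) (c : Option G) : Prop := α = .pop k c ∨ α = .peek k c

/-- The action does not touch stack `k`. -/
def Neut (α : Act K G) (k : K) : Prop := (∀ g, α ≠ .push k g) ∧ (∀ g, α ≠ .pop k (some g))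

variable (M : Mach Λ Q K G)

/-- Runs, newest transition first. -/
inductive Run : List Λ → (K → List G) → Prop
  | start : Run [M.start] (fun _ => [])
  | step (l l' v S S') : Run (l' :: v) S → l ≠ M.start → M.src l = M.tgt l' →
      Apply (M.act l) S S' → Run (l :: l' :: v) S'

/-- Intervals reaching back to where the current top was pushed. -/
inductive U : K → Option G → List Λ → Prop
  | push (k g l) : l ≠ M.start → M.act l = .push k g → U k (some g) [l]
  | start (k) : U k none [M.start]
  | neut (k c l v) : l ≠ M.start → Neut (M.act l) k → U k c v → U k c (l :: v)
  | pop (k g c l v₁ v₂) : l ≠ M.start → M.act l = .pop k (some g) → U k (some g) v₁ → U k c v₂ →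
      U k c (l :: (v₁ ++ v₂))

/-- Grammar rules. -/
inductive Rule : K × Option G → List (Λ ⊕ (K × Option G)) → Prop
  | push (k g l) : l ≠ M.start → M.act l = .push k g → Rule (k, some g) [.inl l]
  | start (k) : Rule (k, none) [.inl M.start]
  | neut (k c l) : l ≠ M.start → Neut (M.act l) k → Rule (k, c) [.inl l, .inr (k, c)]
  | pop (k g c l) : l ≠ M.start → M.act l = .pop k (some g) →
      Rule (k, c) [.inl l, .inr (k, some g), .inr (k, c)]

/-- Forbidden patterns. -/
inductive Forb : List (Λ ⊕ (K × Option G)) → Prop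
  | adj (l l') : ¬ (l ≠ M.start ∧ M.src l = M.tgt l') → Forb [.inl l, .inl l']
  | rd (l k c c') : Reads (M.act l) k c → c ≠ c' → Forb [.inl l, .inr (k, c')]

theorem Rule.len {p q} (h : Rule M p q) : q ≠ [] ∧ q.length ≤ 3 := by cases h <;> simp

theorem Forb.len {q} (h : Forb M q) : q ≠ [] ∧ q.length ≤ 2 := by cases h <;> simp

/-- Semantics of symbol sequences. -/
def Sem : List (Λ ⊕ (K × Option G)) → List Λ → Prop
  | [], w => w = []
  | .inl a :: s, w => ∃ w', w = a :: w' ∧ Sem s w'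
  | .inr p :: s, w => ∃ w₁ w₂, w = w₁ ++ w₂ ∧ U M p.1 p.2 w₁ ∧ Sem s w₂

variable {M}
variable {R : List ((K × Option G) × List (Λ ⊕ (K × Option G)))}
  {F : List (List (Λ ⊕ (K × Option G)))}

theorem sem_of_der (hR : ∀ p, p ∈ R ↔ Rule M p.1 p.2) {s w} (h : DerSeq R s w) : Sem M s w := by
  induction h with
  | nil => rfl
  | letter a s w _ ih => exact ⟨w, rfl, ih⟩
  | nt A rhs s w1 w2 hm _ _ ih1 ih2 =>
    refine ⟨w1, w2, rfl, ?_, ih2⟩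
    have hr := (hR _).1 hm
    cases hr with
    | push k g l h1 h2 =>
      obtain ⟨w', rfl, rfl⟩ := ih1
      exact .push _ _ _ h1 h2
    | start k =>
      obtain ⟨w', rfl, rfl⟩ := ih1
      exact .start _
    | neut k c l h1 h2 =>
      obtain ⟨w', rfl, v1, v2, rfl, h3, rfl⟩ := ih1
      simpa using U.neut _ _ _ _ h1 h2 h3
    | pop k g c l h1 h2 =>
      obtain ⟨w', rfl, v1, v2, rfl, h3, v3, v4, rfl, h4, rfl⟩ := ih1
      simpa using U.pop _ _ _ _ _ _ h1 h2 h3 h4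

theorem der_of_u (hR : ∀ p, p ∈ R ↔ Rule M p.1 p.2) {k c w} (h : U M k c w) :
    DerSeq R [.inr (k, c)] w := by
  induction h with
  | push g l h1 h2 =>
    simpa using DerSeq.nt _ _ _ _ _ ((hR (_, _)).2 (Rule.push k g l h1 h2))
      (.letter _ _ _ .nil) .nil
  | start =>
    simpa using DerSeq.nt _ _ _ _ _ ((hR (_, _)).2 (Rule.start k)) (.letter _ _ _ .nil) .nil
  | neut c l v h1 h2 h3 ih =>
    simpa using DerSeq.nt _ _ _ _ _ ((hR (_, _)).2 (Rule.neut k c l h1 h2))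
      (.letter _ _ _ ih) .nil
  | pop g c l v1 v2 h1 h2 h3 h4 ih1 ih2 =>
    cases ih1 with
    | nt _ rhs _ w1 w2 hm h5 h6 =>
      cases h6
      simpa using DerSeq.nt _ _ _ _ _ ((hR (_, _)).2 (Rule.pop k g c l h1 h2))
        (.letter _ _ _ (.nt _ _ _ _ _ hm h5 ih2)) .nil

theorem U.ne_nil {k c w} (h : U M k c w) : w ≠ [] := by cases h <;> simp

/-- Decomposition of a word according to the content of stack `k`. -/
def Stk (M : Mach Λ Q K G) (k : K) : List G → List Λ → Prop
  | [], v => U M k none v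
  | g :: s, v => ∃ v₁ v₂, v = v₁ ++ v₂ ∧ U M k (some g) v₁ ∧ Stk M k s v₂

theorem Stk.neut {k s v l} (h1 : l ≠ M.start) (h2 : Neut (M.act l) k) (h : Stk M k s v) :
    Stk M k s (l :: v) := by
  cases s with
  | nil => exact U.neut _ _ _ _ h1 h2 h
  | cons g s =>
    obtain ⟨v1, v2, rfl, h3, h4⟩ := h
    exact ⟨l :: v1, v2, rfl, .neut _ _ _ _ h1 h2 h3, h4⟩

theorem Stk.head {k s v} (h : Stk M k s v) : ∃ v₁ v₂, v = v₁ ++ v₂ ∧ U M k s.head? v₁ := by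
  cases s with
  | nil => exact ⟨v, [], by simp, h⟩
  | cons g s =>
    obtain ⟨v1, v2, rfl, h3, h4⟩ := h
    exact ⟨v1, v2, rfl, h3⟩

theorem run_of_avoids (hR : ∀ p, p ∈ R ↔ Rule M p.1 p.2) (hF : ∀ s, s ∈ F ↔ Forb M s) (t : List Λ) :
    Avoids R F (t ++ [M.start]) → ∃ S, Run M (t ++ [M.start]) S ∧
      ∀ k, Stk M k (S k) (t ++ [M.start]) := by
  induction t with
  | nil => intro _; exact ⟨_, .start, fun k => .start k⟩
  | cons l t ih =>
    intro hA
    obtain ⟨S, hS, hk⟩ := ih (by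
      intro s hs a l' b hw
      exact hA s hs (l :: a) l' b (by simp [hw]))
    obtain ⟨l', v, hv⟩ : ∃ l' v, t ++ [M.start] = l' :: v := by
      cases t with
      | nil => exact ⟨_, _, rfl⟩
      | cons a t => exact ⟨_, _, rfl⟩
    simp only [List.cons_append] at hA ⊢
    rw [hv] at hA hS hk ⊢
    have hadj : l ≠ M.start ∧ M.src l = M.tgt l' := by
      by_contra hcon
      exact hA _ ((hF _).2 (.adj l l' hcon)) [] [l, l'] v rfl (.letter _ _ _ (.letter _ _ _ .nil))
    have hrd : ∀ k c, Reads (M.act l) k c → (S k).head? = c := by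
      intro k c hr
      by_contra hcon
      obtain ⟨v1, v2, hv', hU⟩ := (hk k).head
      exact hA _ ((hF _).2 (.rd l k c _ hr (Ne.symm hcon))) [] (l :: v1) v2 (by simp [hv'])
        (.letter _ _ _ (der_of_u hR hU))
    rcases ha : M.act l with _ | ⟨k, g⟩ | ⟨k, c⟩ | ⟨k, c⟩
    · refine ⟨S, .step _ _ _ _ _ hS hadj.1 hadj.2 (by rw [ha]; rfl), fun k => (hk k).neut hadj.1 ?_⟩
      simp [Neut, ha]
    · refine ⟨_, .step _ _ _ _ _ hS hadj.1 hadj.2 (by rw [ha]; rfl), fun k' => ?_⟩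
      by_cases hkk : k' = k
      · subst hkk
        simp only [Function.update_self]
        exact ⟨[l], _, rfl, .push _ _ _ hadj.1 ha, hk _⟩
      · rw [Function.update_of_ne hkk]
        refine (hk k').neut hadj.1 ?_
        simp [Neut, ha, Ne.symm hkk]
    · have hc := hrd k c (.inl ha)
      refine ⟨_, .step _ _ _ _ _ hS hadj.1 hadj.2 (by rw [ha]; exact ⟨hc, rfl⟩), fun k' => ?_⟩
      by_cases hkk : k' = k
      · subst hkk
        simp only [Function.update_self]
        have hh := hk k'
        cases hs : S k' with
        | nil =>
          rw [hs] at hh hc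
          refine hh.neut hadj.1 ?_
          simp at hc
          subst hc
          simp [Neut, ha]
        | cons g s =>
          rw [hs] at hh hc
          simp at hc
          subst hc
          obtain ⟨v1, v2, h0, h3, h4⟩ := hh
          rw [h0]
          cases s with
          | nil => exact .pop _ _ _ _ _ _ hadj.1 ha h3 h4
          | cons g' s' =>
            obtain ⟨v3, v4, rfl, h5, h6⟩ := h4
            exact ⟨l :: (v1 ++ v3), v4, by simp, .pop _ _ _ _ _ _ hadj.1 ha h3 h5, h6⟩
      · rw [Function.update_of_ne hkk]
        refine (hk k').neut hadj.1 ?_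
        simp [Neut, ha, Ne.symm hkk]
    · have hc := hrd k c (.inr ha)
      refine ⟨S, .step _ _ _ _ _ hS hadj.1 hadj.2 (by rw [ha]; exact ⟨hc, rfl⟩),
        fun k => (hk k).neut hadj.1 ?_⟩
      simp [Neut, ha]

theorem Run.inv {l r S} (h : Run M (l :: r) S) (hl : l ≠ M.start) :
    ∃ S₀, Run M r S₀ ∧ Apply (M.act l) S₀ S := by
  cases h with
  | start => exact absurd rfl hl
  | step _ l' v S0 _ h1 h2 h3 h4 => exact ⟨S0, h1, h4⟩

theorem Run.inv_start {r S} (h : Run M (M.start :: r) S) : r = [] ∧ S = fun _ => [] := by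
  cases h with
  | start => exact ⟨rfl, rfl⟩
  | step _ l' v S0 _ h1 h2 h3 h4 => exact absurd rfl h2

theorem Apply.neut {α : Act K G} {S S' : K → List G} {k : K} (h : Apply α S S') (hn : Neut α k) :
    S' k = S k := by
  rcases α with _ | ⟨k', g⟩ | ⟨k', c⟩ | ⟨k', c⟩
  · rw [show S' = S from h]
  · have : k ≠ k' := by rintro rfl; exact hn.1 g rfl
    rw [show S' = _ from h, Function.update_of_ne this]
  · by_cases hk : k = k'
    · subst hk
      rw [h.2, Function.update_self]
      rcases c with _ | g
      · have := h.1
        simp at this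
        simp [this]
      · exact absurd rfl (hn.2 g)
    · rw [h.2, Function.update_of_ne hk]
  · rw [h.2]

theorem U.run {k c v} (h : U M k c v) : ∀ rest S, Run M (v ++ rest) S →
    (c = none → S k = []) ∧ (∀ g, c = some g → ∃ S', Run M rest S' ∧ S k = g :: S' k) := by
  induction h with
  | push g l h1 h2 =>
    intro rest S hr
    obtain ⟨S0, h3, h4⟩ := hr.inv h1
    refine ⟨by simp, ?_⟩
    rintro _ ⟨⟩
    rw [h2] at h4
    exact ⟨S0, h3, by rw [show S = _ from h4]; simp⟩
  | start =>
    intro rest S hr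
    obtain ⟨_, rfl⟩ := hr.inv_start
    simp
  | neut c l v h1 h2 h3 ih =>
    intro rest S hr
    obtain ⟨S0, h4, h5⟩ := hr.inv h1
    rw [h5.neut h2]
    exact ih rest S0 h4
  | pop g c l v1 v2 h1 h2 h3 h4 ih1 ih2 =>
    intro rest S hr
    obtain ⟨S0, h5, h6⟩ := hr.inv h1
    replace h5 : Run M (v1 ++ (v2 ++ rest)) S0 := by rw [← List.append_assoc]; exact h5
    obtain ⟨S1, h7, h8⟩ := (ih1 _ _ h5).2 g rfl
    rw [h2] at h6
    have : S k = S1 k := by rw [h6.2, Function.update_self, h8]; rfl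
    rw [this]
    exact ih2 _ _ h7

theorem Run.suffix {a v : List Λ} (hv : v ≠ []) : ∀ {S}, Run M (a ++ v) S → ∃ S', Run M v S' := by
  induction a with
  | nil => intro S h; exact ⟨S, h⟩
  | cons l a ih =>
    intro S h
    by_cases hl : l = M.start
    · subst hl
      have := (show Run M (M.start :: (a ++ v)) S from h).inv_start.1
      simp at this
      exact absurd this.2 hv
    · obtain ⟨S0, h1, _⟩ := (show Run M (l :: (a ++ v)) S from h).inv hl
      exact ih h1

theorem avoids_of_run (hR : ∀ p, p ∈ R ↔ Rule M p.1 p.2) (hF : ∀ s, s ∈ F ↔ Forb M s) {w : List Λ} {S}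
    (h : Run M w S) : Avoids R F w := by
  intro s hs a v b hw hd
  have hsem := sem_of_der hR hd
  have hf := (hF _).1 hs
  cases hf with
  | adj l l' hn =>
    obtain ⟨w', rfl, w'', rfl, rfl⟩ := hsem
    rw [hw] at h
    obtain ⟨S', h'⟩ := h.suffix (by simp)
    cases h' with
    | step _ _ _ S0 _ h1 h2 h3 h4 => exact hn ⟨h2, h3⟩
  | rd l k c c' hr hc =>
    obtain ⟨w', rfl, v1, v2, rfl, hU, rfl⟩ := hsem
    rw [hw] at h
    obtain ⟨S', h'⟩ := h.suffix (by simp)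
    have hne := hU.ne_nil
    simp only [List.append_nil, List.cons_append] at h' hU
    have hl : l ≠ M.start := by
      rintro rfl
      have := h'.inv_start.1
      simp at this
      exact hne this.1
    obtain ⟨S0, h1, h2⟩ := h'.inv hl
    have h3 : (S0 k).head? = c := by
      rcases hr with hr | hr <;> rw [hr] at h2 <;> exact h2.1
    have h4 := hU.run _ _ h1
    apply hc
    rw [← h3]
    rcases c' with _ | g
    · simp [h4.1 rfl]
    · obtain ⟨S1, _, h5⟩ := h4.2 g rfl
      simp [h5]

theorem exists_lists [Finite Λ] [Finite K] [Finite G] (M : Mach Λ Q K G) :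
    ∃ (R : List ((K × Option G) × List (Λ ⊕ (K × Option G))))
      (F : List (List (Λ ⊕ (K × Option G)))),
      (∀ p, p ∈ R ↔ Rule M p.1 p.2) ∧ (∀ s, s ∈ F ↔ Forb M s) := by
  have h1 : {p : (K × Option G) × List (Λ ⊕ (K × Option G)) | Rule M p.1 p.2}.Finite := by
    refine ((Set.finite_univ (α := K × Option G)).prod
      (List.finite_length_le (Λ ⊕ (K × Option G)) 3)).subset ?_
    intro p hp
    exact ⟨trivial, (Rule.len M hp).2⟩
  have h2 : {s : List (Λ ⊕ (K × Option G)) | Forb M s}.Finite := by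
    refine (List.finite_length_le (Λ ⊕ (K × Option G)) 2).subset ?_
    intro p hp
    exact (Forb.len M hp).2
  exact ⟨h1.toFinset.toList, h2.toFinset.toList, by simp, by simp⟩

/-- Expressions built from a machine: satisfiable iff some run exists. -/
theorem finSat_iff_run [Finite Λ] [Finite K] [Finite G] (M : Mach Λ Q K G) (h : Λ) :
    ∃ (ls : List Λ) (R : List ((K × Option G) × List (Λ ⊕ (K × Option G))))
      (F : List (List (Λ ⊕ (K × Option G)))), ∀ pre : List Λ,
      FinSat (mainE h ls R F pre M.start) ↔
        ∃ t, t ≠ [] ∧ ∃ S, Run M (h :: (t ++ (pre ++ [M.start]))) S := by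
  obtain ⟨R, F, hR, hF⟩ := exists_lists M
  have hls : ∀ a : Λ, a ∈ (Set.finite_univ (α := Λ)).toFinset.toList := by simp
  have hR' : ∀ p ∈ R, p.2 ≠ [] := fun p hp => (Rule.len M ((hR p).1 hp)).1
  have hF' : ∀ s ∈ F, s ≠ [] := fun s hs => (Forb.len M ((hF s).1 hs)).1
  refine ⟨(Set.finite_univ (α := Λ)).toFinset.toList, R, F, fun pre => ⟨fun hs => ?_, ?_⟩⟩
  · obtain ⟨t, ht, hA⟩ := word_of_finSat hls hR' hF' hs
    have := run_of_avoids hR hF (h :: (t ++ pre)) (by simpa using hA)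
    obtain ⟨S, hS, _⟩ := this
    exact ⟨t, ht, S, by simpa using hS⟩
  · rintro ⟨t, ht, S, hS⟩
    exact finSat_of_word hls hR' hF' ht (avoids_of_run hR hF hS)

end
end MW
end DA

namespace DA
namespace MW
open Turing

section
set_option linter.unusedSectionVars false
variable {K G L σ : Type} [DecidableEq K]

/-- Statements of the stack machine. -/
abbrev St (K G L σ : Type) := TM2.Stmt (fun _ : K => G) L σ

/-- Control states. -/
inductive Ctl (K G L σ : Type) : Type
  | pre : Ctl K G L σ
  | done : Ctl K G L σ
  | st : St K G L σ → σ → Ctl K G L σ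

/-- The letters. -/
inductive Lt (K G L σ : Type) (T : L → St K G L σ) (Sup : Finset L) : Type
  | start | h | go | ini | one
  | mic : {q : St K G L σ // some q ∈ TM2.stmts T Sup} → σ → Option G → Lt K G L σ T Sup

instance (T : L → St K G L σ) (Sup : Finset L) [Finite σ] [Finite G] : Finite (Lt K G L σ T Sup) := by
  have h0 : Finite {q : St K G L σ // some q ∈ TM2.stmts T Sup} := by
    apply Finite.of_injective
      (fun q : {q : St K G L σ // some q ∈ TM2.stmts T Sup} =>
        (⟨some q.1, q.2⟩ : {x // x ∈ TM2.stmts T Sup}))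
    intro a b hab
    simp at hab
    exact Subtype.ext hab
  let f : Lt K G L σ T Sup →
      Fin 5 ⊕ ({q : St K G L σ // some q ∈ TM2.stmts T Sup} × σ × Option G) := fun a => match a with
    | .start => .inl 0
    | .h => .inl 1
    | .go => .inl 2
    | .ini => .inl 3
    | .one => .inl 4
    | .mic q v c => .inr (q, v, c)
  apply Finite.of_injective f
  intro a b h
  cases a <;> cases b <;> simp_all [f]

/-- Target of a micro step. -/
def nextSt (T : L → St K G L σ) : St K G L σ → σ → Option G → Ctl K G L σ
  | .push _ _ q, v, _ => .st q v
  | .peek _ f q, v, c => .st q (f v c)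
  | .pop _ f q, v, c => .st q (f v c)
  | .load f q, v, _ => .st q (f v)
  | .branch f a b, v, _ => .st (cond (f v) a b) v
  | .goto f, v, _ => .st (T (f v)) v
  | .halt, _, _ => .done

/-- Action of a micro step. -/
def actOf : St K G L σ → σ → Option G → Act K G
  | .push k f _, v, _ => .push k (f v)
  | .peek k _ _, _, c => .peek k c
  | .pop k _ _, _, c => .pop k c
  | _, _, _ => .nop

/-- The multi-stack machine. -/
def mach (T : L → St K G L σ) (Sup : Finset L) (l₀ : L) (v₀ : σ) (kin : K) (g₀ g₁ : G) :
    Mach (Lt K G L σ T Sup) (Ctl K G L σ) K G where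
  start := .start
  src
    | .h => .done
    | .mic q v _ => .st q.1 v
    | _ => .pre
  tgt
    | .h => .done
    | .go => .st (T l₀) v₀
    | .mic q v c => nextSt T q.1 v c
    | _ => .pre
  act
    | .ini => .push kin g₀
    | .one => .push kin g₁
    | .mic q v c => actOf q.1 v c
    | _ => .nop

variable {T : L → St K G L σ} {Sup : Finset L} {l₀ : L} {v₀ : σ} {kin : K} {g₀ g₁ : G}

/-- The machine can be run along a word into a control state. -/
def Ext (M : Mach (Lt K G L σ T Sup) (Ctl K G L σ) K G) (w : List (Lt K G L σ T Sup))
    (q : Ctl K G L σ) (S : K → List G) : Prop :=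
  ∃ l w', w = l :: w' ∧ M.tgt l = q ∧ Run M w S

theorem Ext.step {M : Mach (Lt K G L σ T Sup) (Ctl K G L σ) K G} {w q S S'} (h : Ext M w q S)
    (l) (h1 : l ≠ M.start) (h2 : M.src l = q) (h3 : Apply (M.act l) S S') :
    Ext M (l :: w) (M.tgt l) S' := by
  obtain ⟨l', w', rfl, h4, h5⟩ := h
  exact ⟨l, _, rfl, rfl, .step _ _ _ _ _ h5 h1 (h2.trans h4.symm) h3⟩

/-- The outcome of a full machine step. -/
def Res (M : Mach (Lt K G L σ T Sup) (Ctl K G L σ) K G) (w : List (Lt K G L σ T Sup))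
    (c : TM2.Cfg (fun _ : K => G) L σ) : Prop :=
  c.l = none ∧ Ext M w .done c.stk ∨ ∃ l ∈ Sup, c.l = some l ∧ Ext M w (.st (T l) c.var) c.stk

theorem Res.glue {M : Mach (Lt K G L σ T Sup) (Ctl K G L σ) K G} {w l c}
    (h : ∃ t, t ≠ [] ∧ Res M (t ++ (l :: w)) c) : ∃ t, t ≠ [] ∧ Res M (t ++ w) c := by
  obtain ⟨t, ht, h⟩ := h
  exact ⟨t ++ [l], by simp, by simpa using h⟩

theorem fwd_stmt (q : St K G L σ) : ∀ v S w, some q ∈ TM2.stmts T Sup → TM2.SupportsStmt Sup q →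
    Ext (mach T Sup l₀ v₀ kin g₀ g₁) w (.st q v) S → ∃ t, t ≠ [] ∧
      Res (mach T Sup l₀ v₀ kin g₀ g₁) (t ++ w) (TM2.stepAux q v S) := by
  induction q with
  | push k f q ih =>
    intro v S w hm hs he
    have h1 := he.step (.mic ⟨_, hm⟩ v none) (by simp [mach]) rfl rfl
    exact Res.glue (ih v _ _ (TM2.stmts_trans (by simp [TM2.stmts₁, TM2.stmts₁_self]) hm) hs h1)
  | peek k f q ih =>
    intro v S w hm hs he
    have h1 := he.step (.mic ⟨_, hm⟩ v (S k).head?) (by simp [mach]) rfl ⟨rfl, rfl⟩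
    exact Res.glue (ih _ _ _ (TM2.stmts_trans (by simp [TM2.stmts₁, TM2.stmts₁_self]) hm) hs h1)
  | pop k f q ih =>
    intro v S w hm hs he
    have h1 := he.step (.mic ⟨_, hm⟩ v (S k).head?) (by simp [mach]) rfl ⟨rfl, rfl⟩
    exact Res.glue (ih _ _ _ (TM2.stmts_trans (by simp [TM2.stmts₁, TM2.stmts₁_self]) hm) hs h1)
  | load f q ih =>
    intro v S w hm hs he
    have h1 := he.step (.mic ⟨_, hm⟩ v none) (by simp [mach]) rfl rfl
    exact Res.glue (ih _ _ _ (TM2.stmts_trans (by simp [TM2.stmts₁, TM2.stmts₁_self]) hm) hs h1)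
  | branch f a b iha ihb =>
    intro v S w hm hs he
    have h1 := he.step (.mic ⟨_, hm⟩ v none) (by simp [mach]) rfl rfl
    simp only [mach, nextSt] at h1
    simp only [TM2.stepAux]
    cases hf : f v
    · rw [hf] at h1
      exact Res.glue
        (ihb _ _ _ (TM2.stmts_trans (by simp [TM2.stmts₁, TM2.stmts₁_self]) hm) hs.2 h1)
    · rw [hf] at h1
      exact Res.glue
        (iha _ _ _ (TM2.stmts_trans (by simp [TM2.stmts₁, TM2.stmts₁_self]) hm) hs.1 h1)
  | goto f =>
    intro v S w hm hs he
    have h1 := he.step (.mic ⟨_, hm⟩ v none) (by simp [mach]) rfl rfl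
    exact ⟨[_], by simp, Or.inr ⟨f v, hs v, rfl, h1⟩⟩
  | halt =>
    intro v S w hm hs he
    have h1 := he.step (.mic ⟨_, hm⟩ v none) (by simp [mach]) rfl rfl
    exact ⟨[_], by simp, Or.inl ⟨rfl, h1⟩⟩

theorem fwd_reach (hs : ∀ l ∈ Sup, TM2.SupportsStmt Sup (T l))
    {c b : TM2.Cfg (fun _ : K => G) L σ} (hr : StateTransition.Reaches (TM2.step T) c b)
    (hb : TM2.step T b = none) : ∀ l ∈ Sup, c.l = some l → ∀ w,
      Ext (mach T Sup l₀ v₀ kin g₀ g₁) w (.st (T l) c.var) c.stk →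
      ∃ t, t ≠ [] ∧ ∃ S, Ext (mach T Sup l₀ v₀ kin g₀ g₁) (t ++ w) .done S := by
  have hmem : ∀ l ∈ Sup, some (T l) ∈ TM2.stmts T Sup := by
    intro l hl
    simp only [TM2.stmts, Finset.mem_insertNone, Finset.mem_biUnion, Option.mem_def,
      Option.some.injEq, forall_eq']
    exact ⟨l, hl, TM2.stmts₁_self⟩
  induction hr using Relation.ReflTransGen.head_induction_on with
  | refl =>
    intro l _ hl
    rcases b with ⟨lb, vb, Sb⟩
    simp only at hl
    subst hl
    simp at hb
  | head h1 h2 ih =>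
    rename_i c c'
    intro l hl hcl w he
    rcases c with ⟨lb, vb, Sb⟩
    simp only at hcl
    subst hcl
    simp at h1
    subst h1
    obtain ⟨t, ht, h | ⟨l', hl', h3, h4⟩⟩ := fwd_stmt (T l) _ _ _ (hmem l hl) (hs l hl) he
    · exact ⟨t, ht, _, h.2⟩
    · obtain ⟨t', ht', S, h5⟩ := ih l' hl' h3 _ h4
      exact ⟨t' ++ t, by simp [ht], S, by simpa using h5⟩

/-- Halting from a control state. -/
def Hlt (T : L → St K G L σ) : Ctl K G L σ → (K → List G) → Prop
  | .st q v, S => (StateTransition.eval (TM2.step T) (TM2.stepAux q v S)).Dom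
  | _, _ => True

theorem eval_step (l : L) (v : σ) (S : K → List G) :
    StateTransition.eval (TM2.step T) (⟨some l, v, S⟩ : TM2.Cfg (fun _ : K => G) L σ) =
      StateTransition.eval (TM2.step T) (TM2.stepAux (T l) v S) :=
  StateTransition.reaches_eval (Relation.ReflTransGen.single rfl)

theorem hlt_back (l : Lt K G L σ T Sup) {S S' : K → List G}
    (ha : Apply ((mach T Sup l₀ v₀ kin g₀ g₁).act l) S S')
    (h : Hlt T ((mach T Sup l₀ v₀ kin g₀ g₁).tgt l) S') :
    Hlt T ((mach T Sup l₀ v₀ kin g₀ g₁).src l) S := by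
  cases l with
  | mic q v c =>
    obtain ⟨q, hq⟩ := q
    cases q with
    | push k f q =>
      simp only [mach, actOf, Apply, nextSt, Hlt] at ha h ⊢
      subst ha; exact h
    | peek k f q =>
      simp only [mach, actOf, Apply, nextSt, Hlt] at ha h ⊢
      obtain ⟨rfl, rfl⟩ := ha; exact h
    | pop k f q =>
      simp only [mach, actOf, Apply, nextSt, Hlt] at ha h ⊢
      obtain ⟨rfl, rfl⟩ := ha; exact h
    | load f q =>
      simp only [mach, actOf, Apply, nextSt, Hlt] at ha h ⊢
      subst ha; exact h
    | branch f a b =>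
      simp only [mach, actOf, Apply, nextSt, Hlt] at ha h ⊢
      subst ha
      cases hf : f v <;> simpa [hf] using h
    | goto f =>
      simp only [mach, actOf, Apply, nextSt, Hlt] at ha h ⊢
      subst ha
      rw [TM2.stepAux, eval_step]; exact h
    | halt =>
      simp only [mach, Hlt]
      rw [Part.dom_iff_mem]
      refine ⟨_, StateTransition.mem_eval.2 ⟨Relation.ReflTransGen.refl, ?_⟩⟩
      simp
  | _ => trivial

theorem back_run (r : Lt K G L σ T Sup) (w : List (Lt K G L σ T Sup)) :
    ∀ (t : List (Lt K G L σ T Sup)) (l : Lt K G L σ T Sup) (S : K → List G),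
      Run (mach T Sup l₀ v₀ kin g₀ g₁) (l :: (t ++ (r :: w))) S →
      Hlt T ((mach T Sup l₀ v₀ kin g₀ g₁).tgt l) S →
      ∃ S', Run (mach T Sup l₀ v₀ kin g₀ g₁) (r :: w) S' ∧
        Hlt T ((mach T Sup l₀ v₀ kin g₀ g₁).tgt r) S' := by
  intro t
  induction t with
  | nil =>
    intro l S hr hh
    cases hr with
    | step _ _ _ S0 _ h1 h2 h3 h4 => exact ⟨S0, h1, h3 ▸ hlt_back l h4 hh⟩
  | cons a t ih =>
    intro l S hr hh
    cases hr with
    | step _ _ _ S0 _ h1 h2 h3 h4 => exact ih a S0 h1 (h3 ▸ hlt_back l h4 hh)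

/-- The input stacks. -/
def inp (kin : K) (g₀ g₁ : G) (n : ℕ) : K → List G :=
  Function.update (fun _ => []) kin (List.replicate n g₁ ++ [g₀])

theorem run_pre (n : ℕ) (S : K → List G) :
    Run (mach T Sup l₀ v₀ kin g₀ g₁) (List.replicate n .one ++ [.ini] ++ [.start]) S ↔
      S = inp kin g₀ g₁ n := by
  induction n generalizing S with
  | zero =>
    constructor
    · intro h
      obtain ⟨S0, h1, h2⟩ := Run.inv (M := mach T Sup l₀ v₀ kin g₀ g₁) h (by simp [mach])
      obtain ⟨_, rfl⟩ := Run.inv_start (M := mach T Sup l₀ v₀ kin g₀ g₁) h1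
      rw [show S = _ from h2]
      simp [inp]
    · rintro rfl
      exact .step _ _ _ _ _ (.start) (by simp [mach]) rfl (by simp [mach, Apply, inp])
  | succ n ih =>
    constructor
    · intro h
      obtain ⟨S0, h1, h2⟩ := Run.inv (M := mach T Sup l₀ v₀ kin g₀ g₁) h (by simp [mach])
      rw [(ih S0).1 h1] at h2
      rw [show S = _ from h2]
      simp [inp, List.replicate_succ]
    · rintro rfl
      have h1 := (ih _).2 rfl
      have h3 : Ext (mach T Sup l₀ v₀ kin g₀ g₁)
          (List.replicate n .one ++ [.ini] ++ [.start]) .pre (inp kin g₀ g₁ n) := by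
        cases n with
        | zero => exact ⟨_, _, rfl, rfl, h1⟩
        | succ n => exact ⟨_, _, rfl, rfl, h1⟩
      obtain ⟨_, _, h4, _, h5⟩ := h3.step (S' := inp kin g₀ g₁ (n + 1)) .one (by simp [mach]) rfl
        (by simp [mach, Apply, inp, List.replicate_succ])
      simpa [List.replicate_succ] using h5

theorem run_iff (hs : ∀ l ∈ Sup, TM2.SupportsStmt Sup (T l)) (hl : l₀ ∈ Sup) (n : ℕ) :
    (∃ t, t ≠ [] ∧ ∃ S, Run (mach T Sup l₀ v₀ kin g₀ g₁)
      (.h :: (t ++ ((.go :: (List.replicate n .one ++ [.ini])) ++ [.start]))) S) ↔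
    (StateTransition.eval (TM2.step T)
      (⟨some l₀, v₀, inp kin g₀ g₁ n⟩ : TM2.Cfg (fun _ : K => G) L σ)).Dom := by
  constructor
  · rintro ⟨t, ht, S, h⟩
    obtain ⟨S', h1, h2⟩ := back_run _ _ t .h S h trivial
    obtain ⟨S0, h3, h4⟩ := Run.inv (M := mach T Sup l₀ v₀ kin g₀ g₁) h1 (by simp [mach])
    have h3' := (run_pre n S0).1 h3
    subst h3'
    rw [show S' = _ from h4] at h2
    rw [eval_step]
    exact h2
  · intro h
    obtain ⟨b, hb⟩ := Part.dom_iff_mem.1 h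
    obtain ⟨h1, h2⟩ := StateTransition.mem_eval.1 hb
    have h3 := (run_pre (T := T) (Sup := Sup) (l₀ := l₀) (v₀ := v₀) (kin := kin) (g₀ := g₀)
      (g₁ := g₁) n _).2 rfl
    have h4 : Ext (mach T Sup l₀ v₀ kin g₀ g₁)
        (List.replicate n .one ++ [.ini] ++ [.start]) .pre (inp kin g₀ g₁ n) := by
      cases n with
      | zero => exact ⟨_, _, rfl, rfl, h3⟩
      | succ n => exact ⟨_, _, rfl, rfl, h3⟩
    have h5 := h4.step (S' := inp kin g₀ g₁ n) .go (by simp [mach]) rfl rfl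
    obtain ⟨t, ht, S, h6⟩ := fwd_reach hs h1 h2 l₀ hl rfl _ h5
    obtain ⟨_, _, _, _, h7⟩ := h6.step (S' := S) .h (by simp [mach]) rfl rfl
    exact ⟨t, ht, S, by simpa using h7⟩

end
end MW
end DA

namespace DA
namespace MW
open Turing

/-- The numbers `2 ^ n - 1`. -/
def dbl (n : ℕ) : ℕ := Nat.rec 0 (fun _ r => 2 * r + 1) n

theorem dbl_succ (n : ℕ) : dbl (n + 1) = 2 * dbl n + 1 := rfl

theorem dbl_strictMono : StrictMono dbl :=
  strictMono_nat_of_lt_succ fun n => by rw [dbl_succ]; omega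

theorem primrec_dbl : Primrec dbl :=
  Primrec.nat_rec₁ 0 (Primrec.nat_add.comp
    (Primrec.nat_mul.comp (Primrec.const 2) Primrec.snd) (Primrec.const 1))

theorem trNat_dbl (n : ℕ) :
    PartrecToTM2.trNat (dbl n) = List.replicate n PartrecToTM2.Γ'.bit1 := by
  induction n with
  | zero => exact PartrecToTM2.trNat_zero
  | succ n ih =>
    rw [dbl_succ, List.replicate_succ, ← ih, PartrecToTM2.trNat, PartrecToTM2.trNat]
    have : ((2 * dbl n + 1 : ℕ) : Num) = Num.bit1 (dbl n : Num) := by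
      rw [← Num.bit1_of_bit1]; push_cast; rw [two_mul]
    rw [this]
    cases (dbl n : Num) <;> rfl

/-- Halting on input zero, with the code given in unary. -/
def haltF (m : ℕ) : Part ℕ :=
  (Nat.rfind fun k => Part.some (decide (dbl k = m))).bind fun k =>
    Nat.Partrec.Code.eval (Denumerable.ofNat Nat.Partrec.Code k) 0

theorem haltF_dbl (n : ℕ) :
    haltF (dbl n) = Nat.Partrec.Code.eval (Denumerable.ofNat Nat.Partrec.Code n) 0 := by
  have h : n ∈ Nat.rfind fun k => Part.some (decide (dbl k = dbl n)) := by
    refine Nat.mem_rfind.2 ⟨by simp, ?_⟩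
    intro m hm
    have := dbl_strictMono hm
    simp
    omega
  rw [haltF, Part.eq_some_iff.2 h, Part.bind_some]

theorem partrec_haltF : Partrec haltF := by
  have h1 : Computable₂ fun (m k : ℕ) => decide (dbl k = m) :=
    (Primrec.eq.decide.comp (primrec_dbl.comp Primrec.snd) Primrec.fst).to_comp
  refine Partrec.bind (Partrec.rfind (p := fun m k => Part.some (decide (dbl k = m))) h1.partrec₂) ?_
  exact Nat.Partrec.Code.eval_part.comp
    ((Computable.ofNat Nat.Partrec.Code).comp Computable.snd) (Computable.const 0)

instance : Finite PartrecToTM2.K' := by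
  refine Finite.of_injective (β := Fin 4) (fun k => match k with
    | .main => 0
    | .rev => 1
    | .aux => 2
    | .stack => 3) ?_
  intro a b h
  cases a <;> cases b <;> simp_all

theorem inp_eq (n : ℕ) : PartrecToTM2.K'.elim (PartrecToTM2.trList [dbl n]) [] [] [] =
    inp PartrecToTM2.K'.main PartrecToTM2.Γ'.cons PartrecToTM2.Γ'.bit1 n := by
  funext k
  cases k <;> simp [inp, PartrecToTM2.trList, trNat_dbl, PartrecToTM2.K'.elim]

/-- The program, with unfolded type. -/
def trT : PartrecToTM2.Λ' → St PartrecToTM2.K' PartrecToTM2.Γ' PartrecToTM2.Λ'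
    (Option PartrecToTM2.Γ') := PartrecToTM2.tr

/-- There is a family of expressions which is satisfiable iff a program halts. -/
theorem exists_family : ∃ (Λ X : Type) (_ : Finite Λ) (_ : Finite X) (h : Λ) (ls : List Λ)
    (R : List (X × List (Λ ⊕ X))) (F : List (List (Λ ⊕ X))) (go one ini start : Λ),
    ∀ n, FinSat (mainE h ls R F (go :: (List.replicate n one ++ [ini])) start) ↔
      (Nat.Partrec.Code.eval (Denumerable.ofNat Nat.Partrec.Code n) 0).Dom := by
  obtain ⟨c, hc⟩ := ToPartrec.Code.exists_code (Nat.Partrec'.part_iff₁.2 partrec_haltF)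
  have hsup := PartrecToTM2.tr_supports c PartrecToTM2.Cont'.halt
  let M := mach (K := PartrecToTM2.K') (G := PartrecToTM2.Γ') (σ := Option PartrecToTM2.Γ')
    trT (PartrecToTM2.codeSupp c PartrecToTM2.Cont'.halt)
    (PartrecToTM2.trNormal c PartrecToTM2.Cont'.halt) none
    PartrecToTM2.K'.main PartrecToTM2.Γ'.cons PartrecToTM2.Γ'.bit1
  obtain ⟨ls, R, F, hM⟩ := finSat_iff_run M .h
  refine ⟨_, _, inferInstance, inferInstance, .h, ls, R, F, .go, .one, .ini, .start, fun n => ?_⟩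
  refine (hM _).trans ?_
  refine (run_iff (T := trT) hsup.2 hsup.1 n).trans ?_
  rw [← inp_eq]
  have h1 := PartrecToTM2.tr_eval c [dbl n]
  have h2 := hc ⟨[dbl n], rfl⟩
  change (StateTransition.eval (TM2.step PartrecToTM2.tr) (PartrecToTM2.init c [dbl n])).Dom ↔ _
  rw [h1, h2]
  change (haltF (dbl n)).Dom ↔ _
  rw [haltF_dbl]

theorem encode_primrec {Λ X : Type} (φ : Nm Λ X → DA Unit) (h : Λ) (ls : List Λ)
    (R : List (X × List (Λ ⊕ X))) (F : List (List (Λ ⊕ X))) (go one ini start : Λ) :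
    Primrec fun n => encodeDA
      (subst φ (mainE h ls R F (go :: (List.replicate n one ++ [ini])) start)) := by
  have hb : ∀ (a d : ℕ) (f : ℕ → ℕ), Primrec f → Primrec fun n => 5 * Nat.pair a (f n) + d :=
    fun a d f hf => Primrec.nat_add.comp (Primrec.nat_mul.comp (Primrec.const 5)
      (Primrec₂.natPair.comp (Primrec.const a) hf)) (Primrec.const d)
  have hs : Primrec fun n => encodeDA (subst φ (sufE (List.replicate n one ++ [ini]) start)) := by
    have h1 : Primrec (Nat.rec (encodeDA (subst φ (sufE [ini] start)))
        (fun _ e => 5 * Nat.pair (encodeDA (subst φ (lam one)))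
          (5 * Nat.pair (encodeDA (subst φ rE)) e + 2) + 4) : ℕ → ℕ) := by
      apply Primrec.nat_rec₁
      exact Primrec.comp (f := fun e : ℕ => 5 * Nat.pair (encodeDA (subst φ (lam one)))
          (5 * Nat.pair (encodeDA (subst φ rE)) e + 2) + 4) (hb _ _ _ (hb _ _ _ Primrec.id)) Primrec.snd
    refine h1.of_eq fun n => ?_
    induction n with
    | zero => rfl
    | succ n ih => simp only [ih]; rfl
  have h2 := hb (encodeDA (subst φ (lam h))) 4 _ (hb (encodeDA (subst φ rE)) 2 _
    (hb (encodeDA (subst φ rE)) 4 _ (hb (encodeDA (subst φ rE)) 2 _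
      (hb (encodeDA (subst φ (lam go))) 4 _ (hb (encodeDA (subst φ rE)) 2 _ hs)))))
  have h3 := Primrec.nat_add.comp (Primrec.nat_mul.comp (Primrec.const 5)
    (Primrec₂.natPair.comp h2
      (Primrec.const (encodeDA (subst φ (ctxR (ctxL (violE h ls R F)))))))) (Primrec.const 3)
  exact h3.of_eq fun n => rfl

end MW
end DA

/-- Finite satisfiability of DA expressions over a single relation name with
difference degree at most two is undecidable: no computable function decides,
given (the code of) an expression e over {a} as input, whether
deg e ≤ 2 and e is finitely satisfiable. -/
theorem stmt0 :
    ¬ ∃ g : ℕ → Bool, Computable g ∧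
        ∀ e : DA Unit, (g (encodeDA e) = true ↔ (DA.deg e ≤ 2 ∧ DA.FinSat e)) := by
  rintro ⟨g, hg, hspec⟩
  obtain ⟨Λ, X, hΛ, hX, h, ls, R, F, go, one, ini, start, hfam⟩ := DA.MW.exists_family
  obtain ⟨φ, hφ0, hφ⟩ := DA.exists_single (DA.Nm Λ X)
  apply ComputablePred.halting_problem 0
  rw [ComputablePred.computable_iff]
  refine ⟨fun c => g (encodeDA (DA.subst φ (DA.mainE h ls R F
    (go :: (List.replicate (Encodable.encode c) one ++ [ini])) start))), ?_, ?_⟩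
  · exact hg.comp ((DA.MW.encode_primrec φ h ls R F go one ini start).to_comp.comp
      Computable.encode)
  · funext c
    rw [hspec, hφ, hfam, DA.deg_subst φ hφ0, Denumerable.ofNat_encode]
    simp [DA.deg_mainE]
end

section
/- There is no algorithm deciding finite satisfiability for DA expressions of difference degree at most two over arbitrary finite vocabularies. Precisely: the set of pairs (Γ, e), where Γ is a finite vocabulary and e is a DA expression over Γ with deg e ≤ 2 that is finitely satisfiable, is not a decidable (computable) set (under any standard effective encoding). -/
/-- A standard effective (injective) encoding of DA expressions over the
vocabulary {a₁, …, a_k} (modelled by Fin k) into the natural numbers. -/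
def encodeDAFin : {k : ℕ} → DA (Fin k) → ℕ
  | _, .var a => 5 * a.val
  | _, .union e f => 5 * Nat.pair (encodeDAFin e) (encodeDAFin f) + 1
  | _, .inter e f => 5 * Nat.pair (encodeDAFin e) (encodeDAFin f) + 2
  | _, .diff e f => 5 * Nat.pair (encodeDAFin e) (encodeDAFin f) + 3
  | _, .comp e f => 5 * Nat.pair (encodeDAFin e) (encodeDAFin f) + 4

namespace DAU
open Turing

/-- A partial recursive function whose value at `4 ^ m` is the `m`-th program run on `0`. -/
def univ0 (n : ℕ) : Part ℕ :=
  (Nat.rfind fun m => Part.some (decide (4 ^ m = n))).bind fun m =>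
    (Denumerable.ofNat Nat.Partrec.Code m).eval 0

theorem pow_primrec : Primrec fun m : ℕ => 4 ^ m := by
  have : Primrec fun m : ℕ => (Nat.rec 1 (fun _ ih => 4 * ih) m : ℕ) :=
    Primrec.nat_rec₁ 1 (Primrec.nat_mul.comp (Primrec.const 4) Primrec.snd).to₂
  refine this.of_eq fun m => ?_
  induction m with
  | zero => rfl
  | succ k ih => rw [pow_succ, mul_comm, ← ih]

theorem univ0_partrec : Partrec univ0 := by
  refine Partrec.bind (Partrec.rfind ?_) ?_
  · have : Primrec fun p : ℕ × ℕ => decide (4 ^ p.2 = p.1) := 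
      (Primrec.eq.comp (pow_primrec.comp Primrec.snd) Primrec.fst).decide
    exact this.to_comp.partrec
  · exact Nat.Partrec.Code.eval_part.comp 
      ((Computable.ofNat Nat.Partrec.Code).comp Computable.snd) (Computable.const 0)

theorem univ0_pow (m : ℕ) : univ0 (4 ^ m) = (Denumerable.ofNat Nat.Partrec.Code m).eval 0 := by
  have : (Nat.rfind fun k => Part.some (decide (4 ^ k = 4 ^ m))) = Part.some m := by
    refine Part.eq_some_iff.2 (Nat.mem_rfind.2 ⟨by simp, fun {k} hk => ?_⟩)
    have : k ≠ m := by omega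
    simp [this]
  rw [univ0, this, Part.bind_some]

theorem univ0_undec : ¬ ComputablePred fun m : ℕ => (univ0 (4 ^ m)).Dom := by
  intro h
  apply ComputablePred.halting_problem 0
  obtain ⟨f, hf, e⟩ := ComputablePred.computable_iff.1 h
  refine ComputablePred.computable_iff.2 ⟨fun c => f (Encodable.encode c), hf.comp Computable.encode, ?_⟩
  funext c
  have := congrFun e (Encodable.encode c)
  rw [← this, univ0_pow, Denumerable.ofNat_encode]

theorem trNat_pow (m : ℕ) : PartrecToTM2.trNat (2 ^ m) =
    List.replicate m PartrecToTM2.Γ'.bit0 ++ [PartrecToTM2.Γ'.bit1] := by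
  have key : ∀ m : ℕ, ∃ p : PosNum, ((2 ^ m : ℕ) : Num) = Num.pos p ∧
     PartrecToTM2.trPosNum p = List.replicate m PartrecToTM2.Γ'.bit0 ++ [PartrecToTM2.Γ'.bit1] := by
    intro m
    induction m with
    | zero => exact ⟨1, by simp; rfl, rfl⟩
    | succ k ih =>
      obtain ⟨p, h1, h2⟩ := ih
      refine ⟨p.bit0, ?_, ?_⟩
      · rw [pow_succ, mul_two, Nat.cast_add, h1]
        have := Num.bit0_of_bit0 (Num.pos p)
        rw [this]; rfl
      · simp [PartrecToTM2.trPosNum, h2, List.replicate_succ]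
  obtain ⟨p, h1, h2⟩ := key m
  rw [PartrecToTM2.trNat, h1]
  exact h2

theorem trInit_pow (m : ℕ) :
    TM2to1.trInit (K := PartrecToTM2.K') (Γ := fun _ => PartrecToTM2.Γ')
      PartrecToTM2.K'.main (PartrecToTM2.trList [4 ^ m]) =
    (true, Function.update (fun _ => none) PartrecToTM2.K'.main (some PartrecToTM2.Γ'.cons)) ::
    (false, Function.update (fun _ => none) PartrecToTM2.K'.main (some PartrecToTM2.Γ'.bit1)) ::
    List.replicate (2 * m)
    (false, Function.update (fun _ => none) PartrecToTM2.K'.main (some PartrecToTM2.Γ'.bit0)) := by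
  have h4 : (4 : ℕ) ^ m = 2 ^ (2 * m) := by rw [pow_mul]; norm_num
  rw [h4]
  simp only [TM2to1.trInit, PartrecToTM2.trList, trNat_pow, List.append_assoc, List.reverse_append,
    List.reverse_replicate]
  have h : ∀ (f : PartrecToTM2.Γ' → TM2to1.Γ' PartrecToTM2.K' (fun _ => PartrecToTM2.Γ')) n a,
      List.replicate n (f a) = List.map f (List.replicate n a) := fun f n a => by
    rw [List.map_replicate]
  have h2 := h (fun a => (false, Function.update (fun _ => none) PartrecToTM2.K'.main (some a)))
    (2 * m) PartrecToTM2.Γ'.bit0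
  refine Eq.trans ?_ (congrArg (fun l => _ :: _ :: l) h2.symm)
  rfl

theorem tm_exists : ∃ (Γ : Type) (_ : Inhabited Γ) (_ : Fintype Γ) (Λ : Type) (_ : Inhabited Λ)
    (M : TM0.Machine Γ Λ) (S : Finset Λ) (a0 a1 x : Γ), TM0.Supports M ↑S ∧
    ¬ ComputablePred fun m : ℕ => (TM0.eval M (a0 :: a1 :: List.replicate (2 * m) x)).Dom := by
  classical
  obtain ⟨c, hc⟩ := ToPartrec.Code.exists_code (Nat.Partrec'.part_iff₁.2 univ0_partrec)
  let _ : Inhabited PartrecToTM2.Λ' := ⟨PartrecToTM2.trNormal c PartrecToTM2.Cont'.halt⟩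
  have hs := PartrecToTM2.tr_supports c PartrecToTM2.Cont'.halt
  let _ : Fintype PartrecToTM2.K' := ⟨{.main, .rev, .aux, .stack}, by intro x; cases x <;> simp⟩
  have hs1 := TM2to1.tr_supports _ hs
  have hs0 := TM1to0.tr_supports _ hs1
  refine ⟨_, inferInstance, inferInstance, _, inferInstance, _, _,
    (true, Function.update (fun _ => none) PartrecToTM2.K'.main (some .cons)),
    (false, Function.update (fun _ => none) PartrecToTM2.K'.main (some .bit1)),
    (false, Function.update (fun _ => none) PartrecToTM2.K'.main (some .bit0)), hs0, ?_⟩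
  intro h
  apply univ0_undec
  refine h.of_eq fun m => ?_
  have e0 := fun l => iff_of_eq (congrArg Part.Dom (TM1to0.tr_eval (TM2to1.tr PartrecToTM2.tr) l))
  refine (e0 _).trans ?_
  have e1 : (univ0 (4 ^ m)).Dom ↔ (c.eval [4 ^ m]).Dom := by
    have := hc ⟨[4 ^ m], rfl⟩
    simp only at this
    rw [this]; rfl
  have e2 : (c.eval [4 ^ m]).Dom ↔
     (TM2.eval PartrecToTM2.tr PartrecToTM2.K'.main (PartrecToTM2.trList [4 ^ m])).Dom := by
    have := PartrecToTM2.tr_eval c [4 ^ m]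
    have i : PartrecToTM2.init c [4 ^ m] = TM2.init PartrecToTM2.K'.main (PartrecToTM2.trList [4 ^ m]) := by
      unfold PartrecToTM2.init TM2.init
      congr 1
      funext k
      cases k <;> rfl
    rw [i] at this
    exact (iff_of_eq (congrArg Part.Dom this)).symm
  refine Iff.trans ?_ (e1.trans (e2.trans (TM2to1.tr_eval_dom _ _ _).symm)).symm
  have := trInit_pow m
  exact iff_of_eq (congrArg (fun l => (TM1.eval (TM2to1.tr PartrecToTM2.tr) l).Dom) this.symm)
end DAU

namespace DAU
open Turing

/-- Global map of a radius-one cellular automaton with local rule `δ`. -/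
def caStep {A : Type} (δ : A → A → A → A) (c : ℤ → A) (i : ℤ) : A :=
  δ (c (i - 1)) (c i) (c (i + 1))

/-- Initial configuration: the word `w` starting at cell `0`, blank elsewhere. -/
def conf {A : Type} (b : A) (w : List A) (i : ℤ) : A :=
  if 0 ≤ i then w.getD i.toNat b else b

/-- The input words. -/
def inWord {A : Type} (a0 a1 x b : A) (m : ℕ) : List A :=
  a0 :: a1 :: (List.replicate (2 * m) x ++ [b])

theorem inWord_getD {A : Type} (a0 a1 x b : A) (m n : ℕ) :
    (inWord a0 a1 x b m).getD (n + 1 + 1) b = if n < 2 * m then x else b := by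
  simp only [inWord, List.getD_eq_getElem?_getD, List.getElem?_cons_succ, List.getElem?_append,
    List.length_replicate, List.getElem?_replicate]
  split_ifs with h
  · rfl
  · rcases n - 2 * m with _ | d <;> simp

theorem repl_getD {A : Type} (a0 a1 x b : A) (m n : ℕ) :
    (a0 :: a1 :: List.replicate (2 * m) x).getD (n + 1 + 1) b = if n < 2 * m then x else b := by
  simp only [List.getD_eq_getElem?_getD, List.getElem?_cons_succ, List.getElem?_replicate]
  split_ifs with h <;> rfl

section sim
variable {Γ Λ : Type} [Inhabited Γ] [Inhabited Λ] (M : TM0.Machine Γ Λ) (S : Finset Λ)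

/-- Cells of the simulating automaton: `none` is the halting signal. -/
abbrev Cell (Γ : Type) {Λ : Type} (S : Finset Λ) : Type := Option (Option {q // q ∈ S} × Γ)

open Classical in
/-- Restriction of states to the finite support. -/
noncomputable def toS (q : {q // q ∈ S}) (q' : Λ) : {q // q ∈ S} :=
  if h : q' ∈ S then ⟨q', h⟩ else q

/-- Head arriving from the left neighbour. -/
noncomputable def fromLeft : Option {q // q ∈ S} × Γ → Option {q // q ∈ S}
  | (none, _) => none
  | (some q, a) => match M q.1 a with
    | some (q', TM0.Stmt.move Dir.right) => some (toS S q q')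
    | _ => none

/-- Head arriving from the right neighbour. -/
noncomputable def fromRight : Option {q // q ∈ S} × Γ → Option {q // q ∈ S}
  | (none, _) => none
  | (some q, a) => match M q.1 a with
    | some (q', TM0.Stmt.move Dir.left) => some (toS S q q')
    | _ => none

/-- The local rule. -/
noncomputable def rule : Cell Γ S → Cell Γ S → Cell Γ S → Cell Γ S
  | some _, some (some q, a), some _ => match M q.1 a with
    | none => none
    | some (q', TM0.Stmt.write b) => some (some (toS S q q'), b)
    | some (_, TM0.Stmt.move _) => some (none, a)
  | some x, some (none, a), some z => some ((fromLeft M S x).or (fromRight M S z), a)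
  | _, _, _ => none

/-- The automaton configuration `c` represents the machine configuration `k`, head at `p`. -/
def Rep (c : ℤ → Cell Γ S) (k : TM0.Cfg Γ Λ) (p : ℤ) : Prop :=
  ∃ h : k.q ∈ S, ∀ i, c i = some (if i = p then some ⟨k.q, h⟩ else none, k.Tape.nth (i - p))

variable {M S}

theorem rep_halt {c : ℤ → Cell Γ S} {k : TM0.Cfg Γ Λ} {p : ℤ} (h : Rep S c k p)
    (hk : TM0.step M k = none) : caStep (rule M S) c p = none := by
  obtain ⟨hq, h⟩ := h
  have hk : M k.q k.Tape.head = none := by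
    simpa [TM0.step] using hk
  simp [caStep, h, rule, Turing.Tape.nth_zero, hk]

theorem rep_step (hS : TM0.Supports M ↑S) {c : ℤ → Cell Γ S} {k k' : TM0.Cfg Γ Λ} {p : ℤ}
    (h : Rep S c k p) (hk : TM0.step M k = some k') :
    ∃ p', Rep S (caStep (rule M S) c) k' p' := by
  have hq' : k'.q ∈ S := TM0.step_supports M hS hk h.1
  obtain ⟨hq, h⟩ := h
  obtain ⟨q, T⟩ := k
  simp only at hq h
  rcases e : M q T.head with _ | ⟨q', s⟩
  · simp [TM0.step, e] at hk
  have hk1 : k'.q = q' := by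
    simp [TM0.step, e] at hk
    rw [← hk]
  have hto : toS S ⟨q, hq⟩ q' = ⟨k'.q, hq'⟩ := by
    subst hk1
    simp [toS, hq']
  have hp : ∀ j, j = p → c j = some (some ⟨q, hq⟩, T.head) := by
    intro j hj
    rw [h, if_pos hj, hj, sub_self]
    rfl
  have hn : ∀ j, j ≠ p → c j = some (none, T.nth (j - p)) := by
    intro j hj
    rw [h, if_neg hj]
  -- cells away from the head
  have key : ∀ j, j ≠ p → caStep (rule M S) c j =
      some ((if j - 1 = p then fromLeft M S (some ⟨q, hq⟩, T.head) else none).or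
        (if j + 1 = p then fromRight M S (some ⟨q, hq⟩, T.head) else none), T.nth (j - p)) := by
    intro j hj
    rw [caStep, hn j hj]
    by_cases h1 : j - 1 = p
    · rw [hp _ h1, hn (j + 1) (by omega), if_pos h1, if_neg (by omega)]
      rfl
    · rw [hn _ h1, if_neg h1]
      by_cases h2 : j + 1 = p
      · rw [hp _ h2, if_pos h2]
        rfl
      · rw [hn _ h2, if_neg h2]
        rfl
  have hsome : ∀ j, ∃ y, c j = some y := fun j => ⟨_, h j⟩
  obtain ⟨y1, hy1⟩ := hsome (p - 1)
  obtain ⟨y2, hy2⟩ := hsome (p + 1)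
  rcases s with d | a
  · have keyp : caStep (rule M S) c p = some (none, T.head) := by
      rw [caStep, hy1, hy2, hp p rfl]
      simp only [rule, e]
    rcases d with _ | _
    · refine ⟨p - 1, hq', fun i => ?_⟩
      have hT : k'.Tape = T.move Dir.left := by
        simp [TM0.step, e] at hk
        rw [← hk]
      rw [hT, Tape.move_left_nth, show i - (p - 1) - 1 = i - p by ring]
      by_cases h1 : i = p
      · rw [h1, keyp, if_neg (by omega), sub_self]
        rfl
      · rw [key i h1]
        have fl : fromLeft M S (some ⟨q, hq⟩, T.head) = none := by simp [fromLeft, e]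
        have fr : fromRight M S (some ⟨q, hq⟩, T.head) = some ⟨k'.q, hq'⟩ := by
          simp [fromRight, e, hto]
        rw [fl, fr, ite_self, Option.none_or]
        simp only [show (i + 1 = p) ↔ (i = p - 1) by omega]
    · refine ⟨p + 1, hq', fun i => ?_⟩
      have hT : k'.Tape = T.move Dir.right := by
        simp [TM0.step, e] at hk
        rw [← hk]
      rw [hT, Tape.move_right_nth, show i - (p + 1) + 1 = i - p by ring]
      by_cases h1 : i = p
      · rw [h1, keyp, if_neg (by omega), sub_self]
        rfl
      · rw [key i h1]
        have fr : fromRight M S (some ⟨q, hq⟩, T.head) = none := by simp [fromRight, e]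
        have fl : fromLeft M S (some ⟨q, hq⟩, T.head) = some ⟨k'.q, hq'⟩ := by
          simp [fromLeft, e, hto]
        rw [fl, fr, ite_self, Option.or_none]
        simp only [show (i - 1 = p) ↔ (i = p + 1) by omega]
  · refine ⟨p, hq', fun i => ?_⟩
    have hT : k'.Tape = T.write a := by
      simp [TM0.step, e] at hk
      rw [← hk]
    rw [hT, Tape.write_nth]
    by_cases h1 : i = p
    · rw [h1, caStep, hy1, hy2, hp p rfl]
      simp only [rule, e, hto, sub_self, if_true]
    · rw [key i h1, if_neg h1, if_neg (show ¬ (i - p = 0) by omega)]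
      have fr : fromRight M S (some ⟨q, hq⟩, T.head) = none := by simp [fromRight, e]
      have fl : fromLeft M S (some ⟨q, hq⟩, T.head) = none := by simp [fromLeft, e]
      rw [fl, fr, ite_self, ite_self, Option.or_none]

theorem rep_reaches (hS : TM0.Supports M ↑S) {k k' : TM0.Cfg Γ Λ} 
    (hr : StateTransition.Reaches (TM0.step M) k k') (c : ℤ → Cell Γ S) (p : ℤ) (h : Rep S c k p) :
    ∃ t p', Rep S ((caStep (rule M S))^[t] c) k' p' := by
  induction hr with
  | refl => exact ⟨0, p, h⟩
  | tail _ h2 ih =>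
    obtain ⟨t, p', h'⟩ := ih
    obtain ⟨p'', h''⟩ := rep_step hS h' h2
    refine ⟨t + 1, p'', ?_⟩
    rw [Function.iterate_succ_apply']
    exact h''

theorem rep_nohalt (hS : TM0.Supports M ↑S) {k : TM0.Cfg Γ Λ} 
    (c : ℤ → Cell Γ S) (p : ℤ) (h : Rep S c k p)
    (hn : ∀ k', StateTransition.Reaches (TM0.step M) k k' → TM0.step M k' ≠ none) (t : ℕ) :
    ∃ k' p', StateTransition.Reaches (TM0.step M) k k' ∧
      Rep S ((caStep (rule M S))^[t] c) k' p' := by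
  induction t with
  | zero => exact ⟨k, p, Relation.ReflTransGen.refl, h⟩
  | succ t ih =>
    obtain ⟨k', p', h1, h2⟩ := ih
    obtain ⟨k'', e⟩ := Option.ne_none_iff_exists'.1 (hn k' h1)
    obtain ⟨p'', h''⟩ := rep_step hS h2 e
    refine ⟨k'', p'', h1.tail e, ?_⟩
    rw [Function.iterate_succ_apply']
    exact h''

theorem rep_iff (hS : TM0.Supports M ↑S) {k : TM0.Cfg Γ Λ} 
    (c : ℤ → Cell Γ S) (p : ℤ) (h : Rep S c k p) :
    (StateTransition.eval (TM0.step M) k).Dom ↔ 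
      ∃ t i, (caStep (rule M S))^[t] c i = none := by
  constructor
  · intro hd
    obtain ⟨k', hk'⟩ := Part.dom_iff_mem.1 hd
    obtain ⟨h1, h2⟩ := StateTransition.mem_eval.1 hk'
    obtain ⟨t, p', h'⟩ := rep_reaches hS h1 c p h
    refine ⟨t + 1, p', ?_⟩
    rw [Function.iterate_succ_apply']
    exact rep_halt h' h2
  · rintro ⟨t, i, hi⟩
    by_contra hd
    obtain ⟨k', p', _, _, h2⟩ := rep_nohalt hS c p h (fun k' h1 h2 =>
      hd (Part.dom_iff_mem.2 ⟨k', StateTransition.mem_eval.2 ⟨h1, h2⟩⟩)) t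
    rw [h2 i] at hi
    cases hi

theorem mk1_nth (l : List Γ) (i : ℤ) : (Tape.mk₁ l).nth i = conf default l i := by
  unfold conf
  split_ifs with h
  · obtain ⟨n, rfl⟩ := Int.eq_ofNat_of_zero_le h
    rw [Tape.mk₁, Tape.mk₂, Tape.mk'_nth_nat, ListBlank.nth_mk]
    simp [List.getI_eq_getElem?_getD]
  · obtain ⟨n, rfl⟩ := Int.eq_negSucc_of_lt_zero (by omega : i < 0)
    simp only [Tape.mk₁, Tape.mk₂, Tape.mk', Tape.nth]
    rw [ListBlank.nth_mk]
    simp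

end sim

theorem ca_exists : ∃ (A : Type) (_ : Fintype A) (δ : A → A → A → A) (b H a0 a1 x : A),
    (∀ y z, δ H y z = H) ∧ (∀ y z, δ y H z = H) ∧ (∀ y z, δ y z H = H) ∧
    ¬ ComputablePred fun m : ℕ => ∃ t i, (caStep δ)^[t] (conf b (inWord a0 a1 x b m)) i = H := by
  classical
  obtain ⟨Γ, _, _, Λ, _, M, S, a0, a1, x, hS, hM⟩ := tm_exists
  refine ⟨Cell Γ S, inferInstance, rule M S, some (none, default), none,
    some (some ⟨default, hS.1⟩, a0), some (none, a1), some (none, x), ?_, ?_, ?_, ?_⟩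
  · intro y z; rfl
  · rintro (_ | y) z <;> rfl
  · rintro (_ | y) (_ | ⟨_ | _, _⟩) <;> rfl
  intro h
  apply hM
  refine h.of_eq fun m => ?_
  refine (rep_iff hS (k := TM0.init (a0 :: a1 :: List.replicate (2 * m) x)) _ 0 ?_).symm
  refine ⟨hS.1, fun i => ?_⟩
  change _ = some (if i = 0 then some (⟨default, hS.1⟩ : {q // q ∈ S}) else none,
    (Tape.mk₁ _).nth (i - 0))
  rw [mk1_nth, sub_zero]
  unfold conf
  by_cases hi : 0 ≤ i
  · obtain ⟨n, rfl⟩ := Int.eq_ofNat_of_zero_le hi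
    rcases n with _ | _ | n
    · simp [inWord]
    · simp [inWord]
    · rw [if_pos hi, if_pos hi, Int.toNat_natCast, inWord_getD, repl_getD,
        if_neg (show ¬ (((n + 1 + 1 : ℕ) : ℤ) = 0) by omega)]
      split_ifs <;> rfl
  · have : i ≠ 0 := by omega
    simp [hi, this]
end DAU

namespace DAU

/-- The data from which the expressions are built: relation names for the order, a weak
identity, the path edges, the grammar symbol, the cell states, and the automaton. -/
structure Ctx (Γ A : Type) where
  O : Γ
  E : Γ
  s : Γ
  G : Γ
  T : A → Γ
  δ : A → A → A → A
  b : A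
  H : A
  a0 : A
  a1 : A
  x : A

namespace Ctx
variable {Γ A : Type} (C : Ctx Γ A)

def o : DA Γ := .var C.O
def ltr (a : A) : DA Γ := .inter (.var C.s) (.var (C.T a))
def sq (X Y : DA Γ) : DA Γ := .comp (.inter X C.o) (.inter Y C.o)
def wrap (X : DA Γ) : DA Γ := .comp C.o (.comp X C.o)

def coreTail : ℕ → DA Γ
  | 0 => C.ltr C.b
  | m + 1 => C.sq (C.ltr C.x) (C.sq (C.ltr C.x) (coreTail m))

def core (m : ℕ) : DA Γ := C.sq (C.ltr C.a0) (C.sq (C.ltr C.a1) (C.coreTail m))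

def rec1 : DA Γ := C.sq (C.ltr C.b) (C.sq (.var C.G) (C.ltr C.b))

def bad1 : DA Γ := .comp (.diff (.comp C.o C.o) C.o) C.o
def bad1' : DA Γ := .comp (.diff (.comp C.o C.o) C.o) (.comp C.o C.o)
def bad2 : DA Γ := .comp C.o (.diff (.comp C.o C.o) C.o)
def bad3 : DA Γ := C.wrap (.diff (.comp C.o C.o) C.o)
def bad4 : DA Γ := C.wrap (.diff C.o (.comp (.var C.E) C.o))
def bad5 : DA Γ :=
  .comp C.o (.comp (.inter (.comp C.o (.var C.E)) (.var C.E)) (.comp C.o C.o))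
def bad6 (p : A × A × A) : DA Γ :=
  C.wrap (.diff
    (.inter (.comp (.var (C.T p.1)) (.comp (.var C.s) (.var C.s)))
      (.inter (.comp (.var C.s) (.comp (.var (C.T p.2.1)) (.var C.s)))
        (.comp (.var C.s) (.comp (.var C.s) (.var (C.T p.2.2))))))
    (.var (C.T (C.δ p.1 p.2.1 p.2.2))))
def bad7 (a : A) : DA Γ := C.wrap (.inter (.var (C.T C.H)) (.var (C.T a)))
def bad8 (m : ℕ) : DA Γ := C.wrap (.diff (.var C.G) (.union (C.core m) C.rec1))

open Classical in
noncomputable def badList [Fintype A] : List (DA Γ) :=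
  [C.bad1', C.bad2, C.bad3, C.bad4, C.bad5] ++
    ((Finset.univ : Finset (A × A × A)).toList.map C.bad6 ++
      ((Finset.univ : Finset A).filter (fun a => a ≠ C.H)).toList.map C.bad7)

noncomputable def badRest [Fintype A] : DA Γ := C.badList.foldr DA.union C.bad1

def top : DA Γ := C.wrap (.inter (.inter (.var C.G) (.var (C.T C.H))) C.o)

noncomputable def expr [Fintype A] (m : ℕ) : DA Γ :=
  .diff C.top (.union (C.bad8 m) C.badRest)

theorem eval_foldr {D : Type} (I : Γ → D → D → Prop) (l : List (DA Γ)) (d : DA Γ) (u v : D) :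
    DA.eval I (l.foldr DA.union d) u v ↔ (DA.eval I d u v ∨ ∃ e ∈ l, DA.eval I e u v) := by
  induction l with
  | nil => simp
  | cons a l ih =>
    simp only [List.foldr_cons, DA.eval, ih, List.mem_cons, exists_eq_or_imp]
    tauto

theorem deg_foldr (l : List (DA Γ)) (d : DA Γ) (hd : d.deg ≤ 1) (hl : ∀ e ∈ l, e.deg ≤ 1) :
    (l.foldr DA.union d).deg ≤ 1 := by
  induction l with
  | nil => exact hd
  | cons a l ih =>
    simp only [List.foldr_cons, DA.deg]
    exact max_le (hl a (by simp)) (ih fun e he => hl e (by simp [he]))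

theorem deg_coreTail (m : ℕ) : (C.coreTail m).deg = 0 := by
  induction m with
  | zero => simp [coreTail, ltr, DA.deg]
  | succ m ih => simp [coreTail, sq, ltr, o, DA.deg, ih]

theorem deg_expr [Fintype A] (m : ℕ) : (C.expr m).deg ≤ 2 := by
  have h : C.badRest.deg ≤ 1 := by
    apply deg_foldr
    · simp [bad1, o, DA.deg]
    · intro e he
      simp only [badList, List.mem_append, List.mem_cons, List.mem_map, List.not_mem_nil,
        or_false] at he
      rcases he with (rfl | rfl | rfl | rfl | rfl) | ⟨p, _, rfl⟩ | ⟨a, _, rfl⟩ <;>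
      simp [bad1', bad2, bad3, bad4, bad5, bad6, bad7, wrap, o, DA.deg]
  have h8 : (C.bad8 m).deg ≤ 1 := by
    simp [bad8, wrap, core, rec1, sq, ltr, o, DA.deg, deg_coreTail]
  have ht : C.top.deg = 0 := by simp [top, wrap, o, DA.deg]
  simp only [expr, DA.deg, ht]
  omega

/-- The relations violated by no pair: unfolding of the expression. -/
theorem eval_badRest [Fintype A] {D : Type} (I : Γ → D → D → Prop) (u v : D) :
    DA.eval I C.badRest u v ↔
      (DA.eval I C.bad1 u v ∨ DA.eval I C.bad1' u v ∨ DA.eval I C.bad2 u v ∨ DA.eval I C.bad3 u v ∨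
      DA.eval I C.bad4 u v ∨ DA.eval I C.bad5 u v ∨ (∃ p, DA.eval I (C.bad6 p) u v) ∨
      ∃ a, a ≠ C.H ∧ DA.eval I (C.bad7 a) u v) := by
  rw [badRest, eval_foldr]
  simp [badList, or_and_right, exists_or]

end Ctx

/-- Labelled paths through nodes satisfying `P`. -/
def LPath {A D : Type} (R : A → D → D → Prop) (P : D → Prop) : List A → D → D → Prop
  | [], u, v => u = v ∧ P u
  | a :: w, u, v => P u ∧ ∃ z, R a u z ∧ LPath R P w z v

theorem LPath.append {A D : Type} {R : A → D → D → Prop} {P : D → Prop} {w w' : List A} {u z v : D}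
    (h : LPath R P w u z) (h' : LPath R P w' z v) : LPath R P (w ++ w') u v := by
  induction w generalizing u with
  | nil => obtain ⟨rfl, _⟩ := h; exact h'
  | cons a w ih =>
    obtain ⟨h1, y, h2, h3⟩ := h
    exact ⟨h1, y, h2, ih h3⟩

theorem LPath.nodes {A D : Type} {R : A → D → D → Prop} {P : D → Prop} {w : List A} {u v : D}
    (b : A) (h : LPath R P w u v) : ∃ p : ℕ → D, p 0 = u ∧ p w.length = v ∧
      (∀ i ≤ w.length, P (p i)) ∧ ∀ i < w.length, R (w.getD i b) (p i) (p (i + 1)) := by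
  induction w generalizing u with
  | nil =>
    obtain ⟨rfl, h⟩ := h
    exact ⟨fun _ => u, rfl, rfl, fun _ _ => h, fun i hi => by simp at hi⟩
  | cons a w ih =>
    obtain ⟨h1, y, h2, h3⟩ := h
    obtain ⟨p, p0, pN, hP, hR⟩ := ih h3
    refine ⟨fun n => Nat.casesOn n u p, rfl, pN, ?_, ?_⟩
    · rintro (_ | i) hi
      · exact h1
      · exact hP i (by simpa using hi)
    · rintro (_ | i) hi
      · simpa [p0] using h2
      · simpa using hR i (by simpa using hi)

theorem inWord_length {A : Type} (a0 a1 x b : A) (m : ℕ) :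
    (inWord a0 a1 x b m).length = 2 * m + 3 := by
  simp [inWord]

theorem pad_getD {A : Type} (b : A) (w : List A) (r i : ℕ) :
    (List.replicate r b ++ (w ++ List.replicate r b)).getD i b = conf b w ((i : ℤ) - r) := by
  unfold conf
  simp only [List.getD_eq_getElem?_getD]
  split_ifs with h
  · have h' : r ≤ i := by omega
    obtain ⟨j, rfl⟩ := Nat.exists_eq_add_of_le h'
    rw [List.getElem?_append_right (by simp)]
    have e : (((r + j : ℕ) : ℤ) - r).toNat = j := by omega
    rw [e]
    simp only [List.length_replicate, Nat.add_sub_cancel_left]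
    rw [List.getElem?_append]
    split_ifs with h2
    · rfl
    · rw [List.getElem?_eq_none (l := w) (by omega), List.getElem?_replicate]
      split_ifs <;> rfl
  · rw [List.getElem?_append_left (by simp; omega), List.getElem?_replicate, if_pos (by omega)]
    rfl

namespace Ctx
variable {Γ A : Type} (C : Ctx Γ A)

theorem path_coreTail {D : Type} {I : Γ → D → D → Prop} {P : D → Prop}
    (hb : ∀ u v z, P u → P v → I C.O u z → I C.O z v → P z) (m : ℕ) (u v : D) (hu : P u) (hv : P v)
    (h : DA.eval I (C.coreTail m) u v) :
    LPath (fun a => DA.eval I (C.ltr a)) P (List.replicate (2 * m) C.x ++ [C.b]) u v := by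
  induction m generalizing u with
  | zero => exact ⟨hu, v, h, rfl, hv⟩
  | succ m ih =>
    obtain ⟨z, ⟨h1, h2⟩, ⟨z', ⟨h3, h4⟩, h5, h6⟩, h7⟩ := h
    have hz : P z := hb u v z hu hv h2 h7
    have hz' : P z' := hb z v z' hz hv h4 h6
    exact ⟨hu, z, h1, hz, z', h3, ih z' hz' h5⟩

theorem path_core {D : Type} {I : Γ → D → D → Prop} {P : D → Prop}
    (hb : ∀ u v z, P u → P v → I C.O u z → I C.O z v → P z) (m : ℕ) (u v : D) (hu : P u) (hv : P v)
    (h : DA.eval I (C.core m) u v) :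
    LPath (fun a => DA.eval I (C.ltr a)) P (inWord C.a0 C.a1 C.x C.b m) u v := by
  obtain ⟨z, ⟨h1, h2⟩, ⟨z', ⟨h3, h4⟩, h5, h6⟩, h7⟩ := h
  have hz : P z := hb u v z hu hv h2 h7
  have hz' : P z' := hb z v z' hz hv h4 h6
  exact ⟨hu, z, h1, hz, z', h3, C.path_coreTail hb m z' v hz' hv h5⟩

theorem path_G {D : Type} {I : Γ → D → D → Prop} {P : D → Prop} (hfin : {z | P z}.Finite)
    (hb : ∀ u v z, P u → P v → I C.O u z → I C.O z v → P z)
    (ht : ∀ u v z, P u → P v → I C.O u z → I C.O z v → I C.O u v)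
    (hi : ∀ u, P u → ¬ I C.O u u) (m : ℕ)
    (hG : ∀ u v, P u → P v → I C.G u v → DA.eval I (.union (C.core m) C.rec1) u v) :
    ∀ (n : ℕ) (u v : D), {z | P z ∧ I C.O u z}.ncard < n → P u → P v → I C.G u v →
      ∃ r, LPath (fun a => DA.eval I (C.ltr a)) P
        (List.replicate r C.b ++ (inWord C.a0 C.a1 C.x C.b m ++ List.replicate r C.b)) u v := by
  intro n
  induction n with
  | zero => intro u v h; omega
  | succ n ih =>
    intro u v hn hu hv h
    rcases hG u v hu hv h with h | h
    · refine ⟨0, ?_⟩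
      simpa using C.path_core hb m u v hu hv h
    · obtain ⟨z, ⟨h1, h2⟩, ⟨z', ⟨h3, h4⟩, h5, h6⟩, h7⟩ := h
      have hz : P z := hb u v z hu hv h2 h7
      have hz' : P z' := hb z v z' hz hv h4 h6
      have hlt : {y | P y ∧ I C.O z y}.ncard < {y | P y ∧ I C.O u y}.ncard := by
        apply Set.ncard_lt_ncard
        · rw [Set.ssubset_iff_of_subset]
          · exact ⟨z, ⟨hz, h2⟩, fun hh => hi z hz hh.2⟩
          · rintro y ⟨hy, hy'⟩
            exact ⟨hy, ht u y z hu hy h2 hy'⟩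
        · exact hfin.subset fun y hy => hy.1
      obtain ⟨r, hr⟩ := ih z z' (by omega) hz hz' h3
      refine ⟨r + 1, ?_⟩
      have h8 : LPath (fun a => DA.eval I (C.ltr a)) P [C.b] z' v := ⟨hz', v, h5, rfl, hv⟩
      have h9 := hr.append h8
      have e : List.replicate (r + 1) C.b ++ (inWord C.a0 C.a1 C.x C.b m ++ List.replicate (r + 1) C.b)
        = C.b :: ((List.replicate r C.b ++ (inWord C.a0 C.a1 C.x C.b m ++ List.replicate r C.b))
          ++ [C.b]) := by
        rw [List.replicate_succ, List.cons_append, ← List.replicate_succ, List.replicate_succ']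
        simp
      rw [e]
      exact ⟨hu, z, h1, h9⟩

theorem sound [Fintype A] (m : ℕ) (h : DA.FinSat (C.expr m)) :
    ∃ t i, (caStep C.δ)^[t] (conf C.b (inWord C.a0 C.a1 C.x C.b m)) i = C.H := by
  obtain ⟨D, I, hI, x0, y0, ⟨x, hx, y, ⟨⟨hxy, hH⟩, hO⟩, hy⟩, hbad⟩ := h
  have hbad8 : ¬ DA.eval I (C.bad8 m) x0 y0 := fun h => hbad (Or.inl h)
  have hrest : ¬ DA.eval I C.badRest x0 y0 := fun h => hbad (Or.inr h)
  rw [eval_badRest] at hrest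
  simp only [not_or, not_exists, not_and] at hrest
  obtain ⟨n1, n1', n2, n3, n4, n5, n6, n7⟩ := hrest
  -- nodes strictly between the anchors
  let P : D → Prop := fun z => I C.O x0 z ∧ I C.O z y0
  have hb : ∀ u v z, P u → P v → I C.O u z → I C.O z v → P z := by
    intro u v z hu hv h1 h2
    have h3 : I C.O x0 z := by
      by_contra h3
      exact n1' ⟨z, ⟨⟨u, hu.1, h1⟩, h3⟩, v, h2, hv.2⟩
    refine ⟨h3, ?_⟩
    by_contra h4
    exact n2 ⟨z, h3, ⟨v, h2, hv.2⟩, h4⟩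
  have ht : ∀ u v z, P u → P v → I C.O u z → I C.O z v → I C.O u v := by
    intro u v z hu hv h1 h2
    by_contra h3
    exact n3 ⟨u, hu.1, v, ⟨⟨z, h1, h2⟩, h3⟩, hv.2⟩
  have hi : ∀ u, P u → ¬ I C.O u u := by
    intro u hu h
    by_cases h1 : ∃ z, I C.E u z ∧ I C.O z u
    · obtain ⟨z, h1, h2⟩ := h1
      exact n5 ⟨u, hu.1, z, ⟨⟨u, h, h1⟩, h1⟩, u, h2, hu.2⟩
    · exact n4 ⟨u, hu.1, u, ⟨h, h1⟩, hu.2⟩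
  have hG : ∀ u v, P u → P v → I C.G u v → DA.eval I (.union (C.core m) C.rec1) u v := by
    intro u v hu hv h
    by_contra h1
    exact hbad8 ⟨u, hu.1, v, ⟨h, h1⟩, hv.2⟩
  have hfin : {z | P z}.Finite := by
    refine ((hI C.O).image Prod.snd).subset ?_
    rintro z hz
    exact ⟨(x0, z), hz.1, rfl⟩
  have hPx : P x := by
    refine ⟨hx, ?_⟩
    by_contra h4
    exact n2 ⟨x, hx, ⟨y, hO, hy⟩, h4⟩
  have hPy : P y := by
    refine ⟨?_, hy⟩
    by_contra h4
    exact n1 ⟨y, ⟨⟨x, hx, hO⟩, h4⟩, hy⟩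
  obtain ⟨r, hr⟩ := C.path_G hfin hb ht hi m hG _ x y (Nat.lt_succ_self _) hPx hPy hxy
  obtain ⟨p, p0, pN, hP, hR⟩ := hr.nodes C.b
  simp only [pad_getD] at hR
  simp only [List.length_append, List.length_replicate, inWord_length] at pN hP hR
  have key : ∀ (t i : ℕ), i + 2 * t + 1 ≤ r + (2 * m + 3 + r) →
      I (C.T ((caStep C.δ)^[t] (conf C.b (inWord C.a0 C.a1 C.x C.b m)) ((i : ℤ) + t - r)))
        (p i) (p (i + 2 * t + 1)) := by
    intro t
    induction t with
    | zero =>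
      intro i hi
      have := (hR i (by omega)).2
      simpa [DA.eval] using this
    | succ t ih =>
      intro i hi
      have s1 := (hR i (by omega)).1
      have s2 := (hR (i + 1) (by omega)).1
      have s3 := (hR (i + 2 * t + 1) (by omega)).1
      have s4 := (hR (i + 2 * t + 2) (by omega)).1
      have k1 := ih i (by omega)
      have k2 := ih (i + 1) (by omega)
      have k3 := ih (i + 2) (by omega)
      by_contra hcon
      rw [Function.iterate_succ_apply', caStep] at hcon
      rw [show ((i : ℤ) + (t + 1 : ℕ) - r - 1) = (i : ℤ) + t - r by push_cast; ring,
        show ((i : ℤ) + (t + 1 : ℕ) - r) = ((i + 1 : ℕ) : ℤ) + t - r by push_cast; ring,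
        show (((i + 1 : ℕ) : ℤ) + t - r + 1) = ((i + 2 : ℕ) : ℤ) + t - r by push_cast; ring,
        show i + 2 * (t + 1) + 1 = i + 2 * t + 2 + 1 by ring] at hcon
      rw [show i + 1 + 2 * t + 1 = i + 2 * t + 2 by ring] at k2
      rw [show i + 2 + 2 * t + 1 = i + 2 * t + 2 + 1 by ring] at k3
      exact n6 (_, _, _) ⟨p i, (hP i (by omega)).1, p (i + 2 * t + 2 + 1),
        ⟨⟨⟨_, k1, _, s3, s4⟩, ⟨_, s1, _, k2, s4⟩, _, s1, _, s2, k3⟩, hcon⟩,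
        (hP (i + 2 * t + 2 + 1) (by omega)).2⟩
  have k := key (r + m + 1) 0 (by omega)
  rw [show 0 + 2 * (r + m + 1) + 1 = r + (2 * m + 3 + r) by ring, p0, pN] at k
  by_contra hne
  exact n7 _ (fun h => hne ⟨_, _, h⟩) ⟨x, hx, y, ⟨hH, k⟩, hy⟩

end Ctx
end DAU

namespace DAU

theorem spread {A : Type} (δ : A → A → A → A) (H : A) (h1 : ∀ y z, δ H y z = H)
    (h2 : ∀ y z, δ y H z = H) (h3 : ∀ y z, δ y z H = H) (c : ℤ → A) (t : ℕ) (i : ℤ)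
    (h : (caStep δ)^[t] c i = H) (d : ℕ) :
    ∀ j : ℤ, |j - i| ≤ d → (caStep δ)^[t + d] c j = H := by
  induction d with
  | zero =>
    intro j hj
    have : j = i := by
      have := abs_nonpos_iff.mp (by simpa using hj : |j - i| ≤ 0)
      omega
    rw [this]; exact h
  | succ d ih =>
    intro j hj
    rw [abs_le] at hj
    rw [← Nat.add_assoc, Function.iterate_succ_apply', caStep]
    push_cast at hj
    by_cases e1 : |j - i| ≤ d
    · rw [ih j e1, h2]
    · rw [abs_le] at e1
      by_cases e2 : i ≤ j
      · rw [ih (j - 1) (abs_le.2 (by omega)), h1]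
      · rw [ih (j + 1) (abs_le.2 (by omega)), h3]

theorem conf_x {A : Type} (a0 a1 x b : A) (m n : ℕ) :
    conf b (inWord a0 a1 x b m) ((n : ℤ) + 2) = if n < 2 * m then x else b := by
  unfold conf
  rw [if_pos (by omega), show ((n : ℤ) + 2).toNat = n + 1 + 1 by omega, inWord_getD]

namespace Ctx
variable {Γ A : Type} (C : Ctx Γ A)

theorem complete_aux [Fintype A] (m r : ℕ) (c : ℕ → ℤ → A)
    (c0 : c 0 = conf C.b (inWord C.a0 C.a1 C.x C.b m))
    (cs : ∀ t i, c (t + 1) i = C.δ (c t (i - 1)) (c t i) (c t (i + 1)))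
    (cH : c (r + m + 1) ((m : ℤ) + 1) = C.H)
    (I : Γ → ℕ → ℕ → Prop)
    (hO : ∀ i j, I C.O i j ↔ i < j ∧ j ≤ 2 * r + 2 * m + 5)
    (hE : ∀ i j, I C.E i j ↔ i = j ∧ j ≤ 2 * r + 2 * m + 5)
    (hs : ∀ i j, I C.s i j ↔ j = i + 1 ∧ j ≤ 2 * r + 2 * m + 5)
    (hG : ∀ i j, I C.G i j ↔ ∃ q ≤ r, i = 1 + q ∧ j + q = 2 * r + 2 * m + 4)
    (hT : ∀ a i j, I (C.T a) i j ↔ j ≤ 2 * r + 2 * m + 5 ∧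
      ∃ t : ℕ, j = i + 2 * t + 1 ∧ a = c t ((i : ℤ) + t - 1 - r)) :
    DA.eval I (C.expr m) 0 (2 * r + 2 * m + 5) := by
  have hL : ∀ a i j, DA.eval I (C.ltr a) i j ↔
      j = i + 1 ∧ j ≤ 2 * r + 2 * m + 5 ∧ a = conf C.b (inWord C.a0 C.a1 C.x C.b m) ((i : ℤ) - 1 - r) := by
    intro a i j
    simp only [ltr, DA.eval, hs, hT, ← c0]
    constructor
    · rintro ⟨⟨e, h⟩, _, t, e', h'⟩
      obtain rfl : t = 0 := by omega
      exact ⟨e, h, by simpa using h'⟩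
    · rintro ⟨e, h, h'⟩
      exact ⟨⟨e, h⟩, h, 0, by omega, by simpa using h'⟩
  have hTail : ∀ n u : ℕ, n ≤ m → u + 2 * n + 1 = r + 2 * m + 4 →
      DA.eval I (C.coreTail n) u (r + 2 * m + 4) := by
    intro n
    induction n with
    | zero =>
      intro u _ hu
      rw [coreTail, hL]
      refine ⟨by omega, by omega, ?_⟩
      rw [show ((u : ℤ) - 1 - r) = ((2 * m : ℕ) : ℤ) + 2 by omega, conf_x, if_neg (by omega)]
    | succ n ih =>
      intro u hn hu
      refine ⟨u + 1, ⟨(hL _ _ _).2 ⟨rfl, by omega, ?_⟩, (hO _ _).2 ⟨by omega, by omega⟩⟩,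
        ⟨u + 2, ⟨(hL _ _ _).2 ⟨rfl, by omega, ?_⟩, (hO _ _).2 ⟨by omega, by omega⟩⟩,
          ih (u + 2) (by omega) (by omega), (hO _ _).2 ⟨by omega, by omega⟩⟩,
        (hO _ _).2 ⟨by omega, by omega⟩⟩
      · rw [show ((u : ℤ) - 1 - r) = ((2 * m - 2 * n - 2 : ℕ) : ℤ) + 2 by omega, conf_x,
          if_pos (by omega)]
      · rw [show (((u + 1 : ℕ) : ℤ) - 1 - r) = ((2 * m - 2 * n - 1 : ℕ) : ℤ) + 2 by omega, conf_x,
          if_pos (by omega)]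
  refine ⟨⟨1, (hO _ _).2 ⟨by omega, by omega⟩, 2 * r + 2 * m + 4,
    ⟨⟨(hG _ _).2 ⟨0, by omega, by omega, by omega⟩,
      (hT _ _ _).2 ⟨by omega, r + m + 1, by omega, ?_⟩⟩, (hO _ _).2 ⟨by omega, by omega⟩⟩,
    (hO _ _).2 ⟨by omega, by omega⟩⟩, ?_⟩
  · rw [← cH]; congr 1; push_cast; ring
  rintro (h8 | hrest)
  · obtain ⟨u, _, v, ⟨h, hn⟩, _⟩ := h8
    obtain ⟨q, hq, rfl, hv⟩ := (hG _ _).1 h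
    apply hn
    rcases hq.lt_or_eq with hq | rfl
    · right
      refine ⟨1 + q + 1, ⟨(hL _ _ _).2 ⟨rfl, by omega, ?_⟩, (hO _ _).2 ⟨by omega, by omega⟩⟩,
        ⟨v - 1, ⟨(hG _ _).2 ⟨q + 1, by omega, by omega, by omega⟩,
          (hO _ _).2 ⟨by omega, by omega⟩⟩, (hL _ _ _).2 ⟨by omega, by omega, ?_⟩,
          (hO _ _).2 ⟨by omega, by omega⟩⟩,
        (hO _ _).2 ⟨by omega, by omega⟩⟩
      · unfold conf; rw [if_neg (by omega)]
      · rw [show (((v - 1 : ℕ) : ℤ) - 1 - r) = ((2 * m + r - q : ℕ) : ℤ) + 2 by omega, conf_x,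
          if_neg (by omega)]
    · left
      obtain rfl : v = q + 2 * m + 4 := by omega
      refine ⟨1 + q + 1, ⟨(hL _ _ _).2 ⟨rfl, by omega, ?_⟩, (hO _ _).2 ⟨by omega, by omega⟩⟩,
        ⟨1 + q + 2, ⟨(hL _ _ _).2 ⟨rfl, by omega, ?_⟩, (hO _ _).2 ⟨by omega, by omega⟩⟩,
          hTail m _ le_rfl (by omega), (hO _ _).2 ⟨by omega, by omega⟩⟩,
        (hO _ _).2 ⟨by omega, by omega⟩⟩
      · rw [show (((1 + q : ℕ) : ℤ) - 1 - q) = 0 by omega]; simp [conf, inWord]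
      · rw [show (((1 + q + 1 : ℕ) : ℤ) - 1 - q) = 1 by omega]; simp [conf, inWord]
  · rw [eval_badRest] at hrest
    have tr : ∀ u v, ¬ DA.eval I (.diff (.comp C.o C.o) C.o) u v := by
      rintro u v ⟨⟨z, h1, h2⟩, h3⟩
      have h1' := (hO _ _).1 h1
      have h2' := (hO _ _).1 h2
      exact h3 ((hO _ _).2 ⟨by omega, by omega⟩)
    rcases hrest with h | h | h | h | h | h | ⟨p, h⟩ | ⟨a, ha, h⟩
    · obtain ⟨z, h, _⟩ := h; exact tr _ _ h
    · obtain ⟨z, h, _⟩ := h; exact tr _ _ h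
    · obtain ⟨z, _, h⟩ := h; exact tr _ _ h
    · obtain ⟨z, _, z', h, _⟩ := h; exact tr _ _ h
    · obtain ⟨z, _, z', ⟨h1, h2⟩, _⟩ := h
      have h1' := (hO _ _).1 h1
      exact h2 ⟨z, (hE _ _).2 ⟨rfl, by omega⟩, h1⟩
    · obtain ⟨z, _, z', ⟨⟨y, h1, h2⟩, h3⟩, _⟩ := h
      have h1' := (hO _ _).1 h1
      have h2' := (hE _ _).1 h2
      have h3' := (hE _ _).1 h3
      omega
    · obtain ⟨u, _, v, ⟨⟨⟨u1, k1, u2, s1, s2⟩, ⟨u3, s3, u4, k2, s4⟩, u5, s5, u6, s6, k3⟩, hn⟩, _⟩ := h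
      apply hn
      obtain ⟨p1, p2, p3⟩ := p
      obtain ⟨_, t1, e1, f1⟩ := (hT _ _ _).1 k1
      obtain ⟨_, t2, e2, f2⟩ := (hT _ _ _).1 k2
      obtain ⟨_, t3, e3, f3⟩ := (hT _ _ _).1 k3
      have s1 := (hs _ _).1 s1
      have s2 := (hs _ _).1 s2
      have s3 := (hs _ _).1 s3
      have s4 := (hs _ _).1 s4
      have s5 := (hs _ _).1 s5
      have s6 := (hs _ _).1 s6
      obtain rfl : t1 = t2 := by omega
      obtain rfl : t1 = t3 := by omega
      refine (hT _ _ _).2 ⟨by omega, t1 + 1, by omega, ?_⟩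
      simp only at f1 f2 f3
      rw [cs, f1, f2, f3,
        show ((u : ℤ) + (t1 + 1 : ℕ) - 1 - r - 1) = (u : ℤ) + t1 - 1 - r by omega,
        show ((u : ℤ) + (t1 + 1 : ℕ) - 1 - r) = (u3 : ℤ) + t1 - 1 - r by omega,
        show ((u3 : ℤ) + t1 - 1 - r + 1) = (u6 : ℤ) + t1 - 1 - r by omega]
    · obtain ⟨u, _, v, ⟨k1, k2⟩, _⟩ := h
      obtain ⟨_, t1, e1, f1⟩ := (hT _ _ _).1 k1
      obtain ⟨_, t2, e2, f2⟩ := (hT _ _ _).1 k2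
      obtain rfl : t1 = t2 := by omega
      exact ha (f2.trans f1.symm)

end Ctx

/-- The concrete context over the names `Fin 4 ⊕ A`, transported along an equivalence. -/
def mkCtx {A Γ : Type} (e : (Fin 4 ⊕ A) ≃ Γ) (δ : A → A → A → A) (b H a0 a1 x : A) : Ctx Γ A where
  O := e (Sum.inl 0)
  E := e (Sum.inl 1)
  s := e (Sum.inl 2)
  G := e (Sum.inl 3)
  T := fun a => e (Sum.inr a)
  δ := δ
  b := b
  H := H
  a0 := a0
  a1 := a1
  x := x

theorem complete {A Γ : Type} [Fintype A] (e : (Fin 4 ⊕ A) ≃ Γ) (δ : A → A → A → A)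
    (b H a0 a1 x : A) (h1 : ∀ y z, δ H y z = H)
    (h2 : ∀ y z, δ y H z = H) (h3 : ∀ y z, δ y z H = H) (m t : ℕ) (i : ℤ)
    (h : (caStep δ)^[t] (conf b (inWord a0 a1 x b m)) i = H) :
    DA.FinSat ((mkCtx e δ b H a0 a1 x).expr m) := by
  obtain ⟨r, hr⟩ : ∃ r : ℕ, r = t + ((m : ℤ) + 1 - i).natAbs := ⟨_, rfl⟩
  let c : ℕ → ℤ → A := fun t => (caStep δ)^[t] (conf b (inWord a0 a1 x b m))
  let J : (Fin 4 ⊕ A) → ℕ → ℕ → Prop := fun n i j => match n with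
    | Sum.inl 0 => i < j ∧ j ≤ 2 * r + 2 * m + 5
    | Sum.inl 1 => i = j ∧ j ≤ 2 * r + 2 * m + 5
    | Sum.inl 2 => j = i + 1 ∧ j ≤ 2 * r + 2 * m + 5
    | Sum.inl 3 => ∃ q ≤ r, i = 1 + q ∧ j + q = 2 * r + 2 * m + 4
    | Sum.inr a => j ≤ 2 * r + 2 * m + 5 ∧
      ∃ t : ℕ, j = i + 2 * t + 1 ∧ a = c t ((i : ℤ) + t - 1 - r)
  refine ⟨ℕ, fun g => J (e.symm g), ?_, 0, 2 * r + 2 * m + 5, ?_⟩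
  · intro g
    refine ((Set.finite_Iic (2 * r + 2 * m + 5)).prod (Set.finite_Iic (2 * r + 2 * m + 5))).subset ?_
    rintro ⟨i, j⟩ hij
    simp only [Set.mem_ofPred_eq] at hij
    simp only [Set.mem_prod, Set.mem_Iic]
    generalize e.symm g = n at hij
    rcases n with n | a
    · fin_cases n
      · have hij : i < j ∧ j ≤ 2 * r + 2 * m + 5 := hij
        omega
      · have hij : i = j ∧ j ≤ 2 * r + 2 * m + 5 := hij
        omega
      · have hij : j = i + 1 ∧ j ≤ 2 * r + 2 * m + 5 := hij
        omega
      · obtain ⟨q, h1, h2, h3⟩ : ∃ q ≤ r, i = 1 + q ∧ j + q = 2 * r + 2 * m + 4 := hij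
        omega
    · obtain ⟨h1, t, h2, _⟩ : j ≤ 2 * r + 2 * m + 5 ∧
        ∃ t : ℕ, j = i + 2 * t + 1 ∧ a = c t ((i : ℤ) + t - 1 - r) := hij
      omega
  · refine (mkCtx e δ b H a0 a1 x).complete_aux m r c rfl ?_ ?_ _ ?_ ?_ ?_ ?_ ?_
    · intro t i
      simp only [c, Function.iterate_succ_apply']
      rfl
    · have := spread δ H h1 h2 h3 _ t i h (r - t + m + 1) ((m : ℤ) + 1)
        (abs_le.2 ⟨by omega, by omega⟩)
      rw [show t + (r - t + m + 1) = r + m + 1 by omega] at this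
      exact this
    · intro i j; simp [mkCtx, J]
    · intro i j; simp [mkCtx, J]
    · intro i j; simp [mkCtx, J]
    · intro i j; simp [mkCtx, J]
    · intro a i j; simp [mkCtx, J]

theorem enc_computable {A : Type} [Fintype A] {k : ℕ} (C : Ctx (Fin k) A) :
    Computable fun m => Nat.pair k (encodeDAFin (C.expr m)) := by
  have hc : ∀ (c : ℕ) (f g : ℕ → ℕ), Primrec f → Primrec g →
      Primrec fun m => 5 * Nat.pair (f m) (g m) + c := by
    intro c f g hf hg
    exact Primrec.nat_add.comp (Primrec.nat_mul.comp (Primrec.const 5) (Primrec₂.natPair.comp hf hg))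
      (Primrec.const c)
  have ht : Primrec fun m => encodeDAFin (C.coreTail m) := by
    have step : Primrec fun ih : ℕ => 5 * Nat.pair
        (encodeDAFin (DA.inter (C.ltr C.x) C.o))
        (5 * Nat.pair (5 * Nat.pair (encodeDAFin (DA.inter (C.ltr C.x) C.o))
          (5 * Nat.pair ih (encodeDAFin C.o) + 2) + 4) (encodeDAFin C.o) + 2) + 4 :=
      hc _ _ _ (Primrec.const _) (hc _ _ _ (hc _ _ _ (Primrec.const _)
        (hc _ _ _ Primrec.id (Primrec.const _))) (Primrec.const _))
    refine (Primrec.nat_rec₁ (encodeDAFin (C.ltr C.b)) (step.comp Primrec.snd).to₂).of_eq ?_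
    intro m
    induction m with
    | zero => rfl
    | succ m ih =>
      simp only [ih]
      simp only [Ctx.coreTail, Ctx.sq, encodeDAFin]
  have hcore : Primrec fun m => encodeDAFin (C.core m) := by
    simp only [Ctx.core, Ctx.sq, encodeDAFin]
    exact hc _ _ _ (Primrec.const _) (hc _ _ _ (hc _ _ _ (Primrec.const _)
        (hc _ _ _ ht (Primrec.const _))) (Primrec.const _))
  have h8 : Primrec fun m => encodeDAFin (C.bad8 m) := by
    simp only [Ctx.bad8, Ctx.wrap, encodeDAFin]
    exact hc _ _ _ (Primrec.const _) (hc _ _ _ (hc _ _ _ (Primrec.const _)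
        (hc _ _ _ hcore (Primrec.const _))) (Primrec.const _))
  have he : Primrec fun m => encodeDAFin (C.expr m) := by
    simp only [Ctx.expr, encodeDAFin]
    exact hc _ _ _ (Primrec.const _) (hc _ _ _ h8 (Primrec.const _))
  exact (Primrec₂.natPair.comp (Primrec.const k) he).to_comp

theorem main : ¬ ∃ g : ℕ → Bool, Computable g ∧ ∀ (k : ℕ) (e : DA (Fin k)),
    (g (Nat.pair k (encodeDAFin e)) = true ↔ (DA.deg e ≤ 2 ∧ DA.FinSat e)) := by
  rintro ⟨g, hg, hspec⟩
  obtain ⟨A, _, δ, b, H, a0, a1, x, h1, h2, h3, hno⟩ := ca_exists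
  apply hno
  let e : (Fin 4 ⊕ A) ≃ Fin (Fintype.card (Fin 4 ⊕ A)) := Fintype.equivFin _
  let C := mkCtx e δ b H a0 a1 x
  rw [ComputablePred.computable_iff]
  refine ⟨fun m => g (Nat.pair _ (encodeDAFin (C.expr m))), hg.comp (enc_computable C), ?_⟩
  funext m
  apply propext
  rw [hspec]
  constructor
  · rintro ⟨t, i, h⟩
    exact ⟨C.deg_expr m, complete e δ b H a0 a1 x h1 h2 h3 m t i h⟩
  · rintro ⟨_, h⟩
    exact C.sound m h

end DAU

/-- Finite satisfiability of DA expressions of difference degree at most two over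
arbitrary finite vocabularies is undecidable: no computable function decides, given
(the code of) a pair (Γ, e) — a finite vocabulary Γ = {a₁, …, a_k} together with a DA
expression e over Γ — whether deg e ≤ 2 and e is finitely satisfiable. -/
theorem stmt1 :
    ¬ ∃ g : ℕ → Bool, Computable g ∧
        ∀ (k : ℕ) (e : DA (Fin k)),
          (g (Nat.pair k (encodeDAFin e)) = true ↔ (DA.deg e ≤ 2 ∧ DA.FinSat e)) := by
  exact DAU.main
end
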